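/- arXiv:1010.5235 — 3 statements merged into one kernel-verified Lean document; each statement's English description precedes it below -/
import Mathlib

section
/- Let P and Q be special polygons (each one is 2-special, 3-special, or 4-special, not necessarily of the same type). If their angle parameters agree, i.e., φ(P) = φ(Q) and α(P) = α(Q), then P and Q are of the same type and are directly similar. -/
open Real EuclideanGeometry

attribute [local instance] Complex.finrank_real_complex_fact

/-- The signed turning angle at the middle vertex `q` of the path `p → q → r`:
the oriented angle from the direction `q - p` to the direction `r - q`,
taken in `(-π, π]`. -/
noncomputable def turn (p q r : ℂ) : ℝ :=
  (Complex.orientation.oangle (q - p) (r - q)).toReal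

/-- A cyclic sequence of vertices in the plane bounds a simple polygon:
all edges are nondegenerate, consecutive edges meet exactly in their shared
vertex, and non-adjacent edges are disjoint. -/
def IsSimplePolygon {n : ℕ} [NeZero n] (v : Fin n → ℂ) : Prop :=
  (∀ i, v i ≠ v (i + 1)) ∧
  (∀ i : Fin n, segment ℝ (v i) (v (i + 1)) ∩ segment ℝ (v (i + 1)) (v (i + 2)) = {v (i + 1)}) ∧
  (∀ i j : Fin n, j ≠ i → j ≠ i + 1 → j + 1 ≠ i →
    segment ℝ (v i) (v (i + 1)) ∩ segment ℝ (v j) (v (j + 1)) = ∅)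

/-- A simple polygon is positively (counterclockwisely) oriented when the sum
of its signed turning angles is `2π`. -/
def IsCCW {n : ℕ} [NeZero n] (v : Fin n → ℂ) : Prop :=
  ∑ i : Fin n, turn (v (i - 1)) (v i) (v (i + 1)) = 2 * π

/-- The interior angle of a counterclockwisely ordered simple polygon at its
`i`-th vertex: `π` minus the signed turning angle there.  It may exceed `π`
(at reflex vertices). -/
noncomputable def intAngle {n : ℕ} [NeZero n] (v : Fin n → ℂ) (i : Fin n) : ℝ :=
  π - turn (v (i - 1)) (v i) (v (i + 1))

/-- A 2-special polygon: a simple quadrilateral with counterclockwise vertices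
`a, c', d, c''` whose interior angle at `a` is `4π/3`, whose interior angles at
`c'` and `c''` are less than `π`, whose interior angle at `d` is `π/3`, and with
`c'`, `d`, `c''` equidistant from `a`. -/
def Is2Special (a c' d c'' : ℂ) : Prop :=
  IsSimplePolygon ![a, c', d, c''] ∧ IsCCW ![a, c', d, c''] ∧
  intAngle ![a, c', d, c''] 0 = 4 * π / 3 ∧
  intAngle ![a, c', d, c''] 1 < π ∧
  intAngle ![a, c', d, c''] 3 < π ∧
  intAngle ![a, c', d, c''] 2 = π / 3 ∧
  dist a c' = dist a d ∧ dist a d = dist a c''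

/-- A 3-special polygon: a simple pentagon with counterclockwise vertices
`a, c', e', e'', c''` whose interior angle at `a` is `4π/3`, all other interior
angles being less than `π`, with interior angles `π/3` at `c'` and `c''`,
`dist a c' = dist a c''`, sides `c'e'` and `c''e''` parallel and of equal
length, and interior angles `π/2` at `e'` and `e''`. -/
def Is3Special (a c' e' e'' c'' : ℂ) : Prop :=
  IsSimplePolygon ![a, c', e', e'', c''] ∧ IsCCW ![a, c', e', e'', c''] ∧
  intAngle ![a, c', e', e'', c''] 0 = 4 * π / 3 ∧
  (∀ i : Fin 5, i ≠ 0 → intAngle ![a, c', e', e'', c''] i < π) ∧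
  intAngle ![a, c', e', e'', c''] 1 = π / 3 ∧
  intAngle ![a, c', e', e'', c''] 4 = π / 3 ∧
  dist a c' = dist a c'' ∧
  (∃ r : ℝ, e'' - c'' = r • (e' - c')) ∧
  dist c' e' = dist c'' e'' ∧
  intAngle ![a, c', e', e'', c''] 2 = π / 2 ∧
  intAngle ![a, c', e', e'', c''] 3 = π / 2

/-- A 4-special polygon: a simple hexagon with counterclockwise vertices
`a, c', e', f', e'', c''` whose interior angle at `a` is `4π/3`, all other
interior angles being less than `π`, with interior angles `π/3` at `c'` and
`c''`, `dist a c' = dist a c''`, sides `c'e'` and `c''e''` parallel and of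
equal length, and `e'`, `f'`, `e''` equidistant from `a`. -/
def Is4Special (a c' e' f' e'' c'' : ℂ) : Prop :=
  IsSimplePolygon ![a, c', e', f', e'', c''] ∧ IsCCW ![a, c', e', f', e'', c''] ∧
  intAngle ![a, c', e', f', e'', c''] 0 = 4 * π / 3 ∧
  (∀ i : Fin 6, i ≠ 0 → intAngle ![a, c', e', f', e'', c''] i < π) ∧
  intAngle ![a, c', e', f', e'', c''] 1 = π / 3 ∧
  intAngle ![a, c', e', f', e'', c''] 5 = π / 3 ∧
  dist a c' = dist a c'' ∧
  (∃ r : ℝ, e'' - c'' = r • (e' - c')) ∧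
  dist c' e' = dist c'' e'' ∧
  dist a e' = dist a f' ∧ dist a f' = dist a e''

/-- A special polygon: one that is 2-, 3- or 4-special, recorded together with
its labeled vertices. -/
inductive SpecialPolygon : Type
  | two (a c' d c'' : ℂ) (h : Is2Special a c' d c'') : SpecialPolygon
  | three (a c' e' e'' c'' : ℂ) (h : Is3Special a c' e' e'' c'') : SpecialPolygon
  | four (a c' e' f' e'' c'' : ℂ) (h : Is4Special a c' e' f' e'' c'') : SpecialPolygon

/-- The angle parameter `φ` of a special polygon. -/
noncomputable def SpecialPolygon.phi : SpecialPolygon → ℝ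
  | .two _ _ _ _ _ => 0
  | .three a c' e' _ _ _ => EuclideanGeometry.angle c' a e'
  | .four a c' e' _ _ _ _ => EuclideanGeometry.angle c' a e'

/-- The angle parameter `α` of a special polygon. -/
noncomputable def SpecialPolygon.alpha : SpecialPolygon → ℝ
  | .two a c' d _ _ => EuclideanGeometry.angle a c' d
  | .three a _ e' e'' _ _ => EuclideanGeometry.angle a e' e''
  | .four a _ e' f' _ _ _ => EuclideanGeometry.angle a e' f'

/-- The labeled vertex list of a special polygon (its length records the type:
4, 5 or 6 vertices for 2-, 3- or 4-special respectively). -/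
def SpecialPolygon.vertices : SpecialPolygon → List ℂ
  | .two a c' d c'' _ => [a, c', d, c'']
  | .three a c' e' e'' c'' _ => [a, c', e', e'', c'']
  | .four a c' e' f' e'' c'' _ => [a, c', e', f', e'', c'']


open ComplexConjugate

/-- The primitive cube root of unity in coordinates. -/
noncomputable def omg : ℂ := ⟨-1/2, √3/2⟩

lemma omg_re : omg.re = -1/2 := rfl
lemma omg_im : omg.im = √3/2 := rfl

lemma turn_eq_arg (p q r : ℂ) : turn p q r = Complex.arg (conj (q - p) * (r - q)) := by
  unfold turn
  rw [Complex.oangle, Complex.arg_coe_angle_toReal_eq_arg]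

lemma turn_affine (a S p q r : ℂ) (hS : S ≠ 0) :
    turn (a + S * p) (a + S * q) (a + S * r) = turn p q r := by
  rw [turn_eq_arg, turn_eq_arg]
  have h : conj (a + S * q - (a + S * p)) * (a + S * r - (a + S * q))
      = ((Complex.normSq S : ℝ) : ℂ) * (conj (q - p) * (r - q)) := by
    rw [Complex.normSq_eq_conj_mul_self]
    simp only [map_add, map_sub, map_mul]
    ring
  rw [h, Complex.arg_real_mul _ (Complex.normSq_pos.2 hS)]

lemma of_arg {w : ℂ} {θ : ℝ} (h : Complex.arg w = θ) :
    w.re = ‖w‖ * cos θ ∧ w.im = ‖w‖ * sin θ := by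
  subst h
  exact ⟨(Complex.norm_mul_cos_arg w).symm, (Complex.norm_mul_sin_arg w).symm⟩

lemma cos_two_thirds : cos (2 * π / 3) = -1/2 := by
  rw [show 2 * π / 3 = π - π / 3 by ring, cos_pi_sub, cos_pi_div_three]; ring

lemma sin_two_thirds : sin (2 * π / 3) = √3/2 := by
  rw [show 2 * π / 3 = π - π / 3 by ring, sin_pi_sub, sin_pi_div_three]

lemma sq3 : √3 * √3 = 3 := Real.mul_self_sqrt (by norm_num)

/-- Location of `c''`. -/
lemma locate_c2 {a c1 c2 : ℂ} (hc : c1 ≠ a) (t0 : turn c2 a c1 = -(π/3))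
    (d : dist a c1 = dist a c2) : c2 = a + (c1 - a) * (-1 - omg) := by
  have hS : c1 - a ≠ 0 := sub_ne_zero.2 hc
  obtain ⟨z, hz⟩ : ∃ z, c2 = a + (c1 - a) * z := ⟨(c2 - a) / (c1 - a), by field_simp; ring⟩
  have e1 : c1 = a + (c1 - a) * 1 := by ring
  have e0 : a = a + (c1 - a) * 0 := by ring
  have t0' : turn z 0 1 = -(π/3) := by
    rw [← t0, hz, ← turn_affine a (c1 - a) z 0 1 hS, ← e1, ← e0]
  have hn : ‖z‖ = 1 := by
    rw [dist_comm, Complex.dist_eq, dist_comm, Complex.dist_eq, hz] at d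
    have : ‖c1 - a‖ * ‖z‖ = ‖c1 - a‖ * 1 := by rw [← norm_mul, mul_one, d]; congr 1; ring
    exact mul_left_cancel₀ (norm_ne_zero_iff.2 hS) this
  rw [turn_eq_arg] at t0'
  obtain ⟨h1, h2⟩ := of_arg t0'
  have hn' : ‖conj (0 - z) * (1 - 0)‖ = 1 := by simp [hn]
  rw [hn', cos_neg, cos_pi_div_three] at h1
  rw [hn', sin_neg, sin_pi_div_three] at h2
  simp at h1 h2
  rw [hz]
  congr 2
  apply Complex.ext <;> simp [omg_re, omg_im] <;> linarith

/-- Location of all the points of the base part of a 3- or 4-special polygon. -/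
lemma base {a c1 e1 e2 c2 : ℂ} (hc : c1 ≠ a) (hce : c1 ≠ e1)
    (t0 : turn c2 a c1 = -(π/3)) (t1 : turn a c1 e1 = 2 * π / 3)
    (t4 : turn e2 c2 a = 2 * π / 3)
    (d1 : dist a c1 = dist a c2) (d2 : dist c1 e1 = dist c2 e2) :
    ∃ ρ : ℝ, 0 < ρ ∧ e1 = a + (c1 - a) * (1 + ρ * omg) ∧
      c2 = a + (c1 - a) * (-1 - omg) ∧ e2 = a + (c1 - a) * (-1 - omg + ρ * omg) := by
  have hS : c1 - a ≠ 0 := sub_ne_zero.2 hc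
  have hc2 := locate_c2 hc t0 d1
  obtain ⟨z, hz⟩ : ∃ z, e1 = a + (c1 - a) * (1 + z) :=
    ⟨(e1 - c1) / (c1 - a), by field_simp; ring⟩
  obtain ⟨w, hw⟩ : ∃ w, e2 = a + (c1 - a) * (-1 - omg + w) :=
    ⟨(e2 - a) / (c1 - a) + 1 + omg, by field_simp; ring⟩
  have x1 : c1 = a + (c1 - a) * 1 := by ring
  have x0 : a = a + (c1 - a) * 0 := by ring
  have t1' : turn 0 1 (1 + z) = 2 * π / 3 := by
    rw [← t1, hz, ← turn_affine a (c1 - a) 0 1 _ hS, ← x1, ← x0]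
  have t4' : turn (-1 - omg + w) (-1 - omg) 0 = 2 * π / 3 := by
    rw [← t4, hw, hc2, ← turn_affine a (c1 - a) _ _ 0 hS, ← x0]
  have hn : ‖w‖ = ‖z‖ := by
    rw [dist_comm, Complex.dist_eq, dist_comm c2, Complex.dist_eq] at d2
    have h1 : e1 - c1 = (c1 - a) * z := by rw [hz]; ring
    have h2 : e2 - c2 = (c1 - a) * w := by rw [hw, hc2]; ring
    rw [h1, h2, norm_mul, norm_mul] at d2
    exact (mul_left_cancel₀ (norm_ne_zero_iff.2 hS) d2).symm
  have hz0 : z ≠ 0 := by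
    rintro rfl
    apply hce; rw [hz]; ring
  rw [turn_eq_arg] at t1' t4'
  obtain ⟨h1, h2⟩ := of_arg t1'
  obtain ⟨h3, h4⟩ := of_arg t4'
  rw [show conj ((1:ℂ) - 0) * (1 + z - 1) = z by simp] at h1 h2
  have hnn : ‖(0:ℂ) - (-1 - omg)‖ = 1 := by
    rw [← sq_eq_sq₀ (norm_nonneg _) zero_le_one, ← Complex.normSq_eq_norm_sq,
      Complex.normSq_apply]
    simp [omg_re, omg_im]
    nlinarith [sq3]
  have hn' : ‖conj (-1 - omg - (-1 - omg + w)) * (0 - (-1 - omg))‖ = ‖z‖ := by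
    rw [norm_mul, Complex.norm_conj, hnn, mul_one, ← hn, ← norm_neg w]; congr 1; ring
  rw [hn', cos_two_thirds] at h3
  rw [hn', sin_two_thirds] at h4
  rw [cos_two_thirds] at h1
  rw [sin_two_thirds] at h2
  simp [omg_re, omg_im] at h3 h4
  refine ⟨‖z‖, norm_pos_iff.2 hz0, ?_, hc2, ?_⟩
  · rw [hz]; congr 3
    apply Complex.ext <;> simp [omg_re, omg_im] <;> linarith
  · rw [hw]; congr 3
    have := sq3
    apply Complex.ext
    · simp [omg_re, omg_im]
      linear_combination (-1/2) * h3 - √3/2 * h4 + (-w.re/4 - ‖z‖ / 4) * this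
    · simp [omg_re, omg_im]
      linear_combination (-√3/2) * h3 + 1/2 * h4 - w.im/4 * this

/-- The angle at the base of an isosceles triangle. -/
lemma cos_sq_angle {a e g : ℂ} (he : e ≠ a) (hg : ‖g‖ = 1) (hg1 : g ≠ 1) :
    cos (EuclideanGeometry.angle a e (a + (e - a) * g)) ^ 2 = (1 - g.re) / 2 := by
  unfold EuclideanGeometry.angle
  rw [InnerProductGeometry.cos_angle]
  have h1 : a -ᵥ e = -(e - a) := by simp
  have h2 : a + (e - a) * g -ᵥ e = (e - a) * (g - 1) := by simp; ring
  have hS : e - a ≠ 0 := sub_ne_zero.2 he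
  rw [h1, h2]
  generalize e - a = S at hS
  have hN : g.re * g.re + g.im * g.im = 1 := by
    rw [← Complex.normSq_apply, Complex.normSq_eq_norm_sq, hg]; norm_num
  have hS2 : ‖S‖ ^ 2 = S.re * S.re + S.im * S.im := by
    rw [← Complex.normSq_apply, Complex.normSq_eq_norm_sq]
  have hg2 : ‖g - 1‖ ^ 2 = 2 * (1 - g.re) := by
    rw [← Complex.normSq_eq_norm_sq, Complex.normSq_apply]
    simp; linarith
  have hi : inner ℝ (-S) (S * (g - 1)) = ‖S‖ ^ 2 * (1 - g.re) := by
    rw [hS2, Complex.inner]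
    simp; ring
  have hgp : 0 < ‖g - 1‖ ^ 2 := by
    have := norm_pos_iff.2 (sub_ne_zero.2 hg1); positivity
  have hre : 1 - g.re ≠ 0 := by intro h; rw [hg2, h] at hgp; simp at hgp
  have hS0 : ‖S‖ ≠ 0 := norm_ne_zero_iff.2 hS
  rw [hi, norm_neg, norm_mul, div_pow, mul_pow, mul_pow, mul_pow, hg2]
  field_simp

lemma g_unique {a e a' e' g g' : ℂ} (he : e ≠ a) (he' : e' ≠ a')
    (hg : ‖g‖ = 1) (hg1 : g ≠ 1) (hg' : ‖g'‖ = 1) (hg1' : g' ≠ 1)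
    (hi : 0 ≤ g.im) (hi' : 0 ≤ g'.im)
    (h : EuclideanGeometry.angle a e (a + (e - a) * g) =
      EuclideanGeometry.angle a' e' (a' + (e' - a') * g')) : g = g' := by
  have h1 := cos_sq_angle he hg hg1
  have h2 := cos_sq_angle he' hg' hg1'
  rw [h] at h1
  have hre : g.re = g'.re := by linarith
  have hN : g.re * g.re + g.im * g.im = 1 := by
    rw [← Complex.normSq_apply, Complex.normSq_eq_norm_sq, hg]; norm_num
  have hN' : g'.re * g'.re + g'.im * g'.im = 1 := by
    rw [← Complex.normSq_apply, Complex.normSq_eq_norm_sq, hg']; norm_num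
  apply Complex.ext hre
  rw [hre] at hN
  exact (mul_self_inj hi hi').1 (by linarith)

lemma E_im (ρ : ℝ) : (1 + ρ * omg).im = ρ * (√3/2) := by simp [omg_im]
lemma E_re (ρ : ℝ) : (1 + ρ * omg).re = 1 - ρ / 2 := by simp [omg_re]; ring

lemma E_im_pos {ρ : ℝ} (h : 0 < ρ) : 0 < (1 + ρ * omg).im := by
  rw [E_im]; positivity

lemma E_ne {ρ : ℝ} (h : 0 < ρ) : (1 + ρ * omg) ≠ 0 := by
  intro h0
  have := E_im_pos h
  rw [h0] at this; simp at this

lemma phi_eq {a c : ℂ} (hc : c ≠ a) {ρ : ℝ} (h : 0 < ρ) :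
    EuclideanGeometry.angle c a (a + (c - a) * (1 + ρ * omg)) = Complex.arg (1 + ρ * omg) := by
  have hS : c - a ≠ 0 := sub_ne_zero.2 hc
  rw [EuclideanGeometry.angle_comm]
  unfold EuclideanGeometry.angle
  have h2 : a + (c - a) * (1 + ρ * omg) -ᵥ a = (c - a) * (1 + ρ * omg) := by simp
  rw [h2, vsub_eq_sub, Complex.angle_eq_abs_arg (mul_ne_zero hS (E_ne h)) hS,
    mul_div_cancel_left₀ _ hS, abs_of_nonneg]
  exact Complex.arg_nonneg_iff.2 (E_im_pos h).le

lemma phi_ne_zero {ρ : ℝ} (h : 0 < ρ) : Complex.arg (1 + ρ * omg) ≠ 0 := by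
  intro h0
  have := E_im_pos h
  have h1 := (Complex.arg_eq_zero_iff.1 h0).2
  linarith

lemma rho_unique {ρ ρ' : ℝ} (h : 0 < ρ) (h' : 0 < ρ')
    (he : Complex.arg (1 + ρ * omg) = Complex.arg (1 + ρ' * omg)) : ρ = ρ' := by
  rw [Complex.arg_eq_arg_iff (E_ne h) (E_ne h')] at he
  set k : ℝ := ‖1 + (ρ':ℂ) * omg‖ / ‖1 + (ρ:ℂ) * omg‖ with hk
  have he2 : (k : ℂ) * (1 + ρ * omg) = 1 + ρ' * omg := by rw [← he, hk]; push_cast; rfl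
  have h1 := congrArg Complex.re he2
  have h2 := congrArg Complex.im he2
  rw [Complex.re_ofReal_mul, E_re, E_re] at h1
  rw [Complex.im_ofReal_mul, E_im, E_im] at h2
  have h3 : k * ρ = ρ' := by
    have : (√3/2) ≠ 0 := by positivity
    apply mul_right_cancel₀ this; linarith
  have : k = 1 := by linarith
  rw [this] at h3; linarith

/-- Ratio of `e''` to `e'`. -/
lemma norm_E2 (ρ : ℝ) : ‖-1 - omg + ρ * omg‖ = ‖1 + ρ * omg‖ := by
  rw [← sq_eq_sq₀ (norm_nonneg _) (norm_nonneg _), ← Complex.normSq_eq_norm_sq,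
      ← Complex.normSq_eq_norm_sq, Complex.normSq_apply, Complex.normSq_apply]
  simp [omg_re, omg_im]
  nlinarith [sq3]

lemma turn_pos_im {p q r : ℂ} (h : 0 < turn p q r) : 0 ≤ (conj (q - p) * (r - q)).im := by
  rw [turn_eq_arg] at h
  exact Complex.arg_nonneg_iff.1 h.le

lemma real_ineq {s h y m : ℝ} (hs : 0 < s) (hN : y^2 + m^2 = h^2 + s^2)
    (h1 : -s ≤ m) (h2 : m ≤ s) (h3 : h ≤ y) (n1 : ¬ (y = h ∧ m = s))
    (n2 : ¬ (y = h ∧ m = -s)) : 0 ≤ h * m + s * y := by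
  rcases le_or_gt 0 h with hh | hh
  · nlinarith
  · have hm : m^2 ≤ s^2 := by nlinarith
    by_cases hy : -h ≤ y
    · nlinarith
    · exfalso
      have : y = h := by nlinarith
      subst this
      have : (m - s) * (m + s) = 0 := by nlinarith
      rcases mul_eq_zero.1 this with h | h
      · exact n1 ⟨rfl, by linarith⟩
      · exact n2 ⟨rfl, by linarith⟩

lemma f_side {ρ : ℝ} (hρ : 0 < ρ) {F : ℂ} (hN : ‖F‖ = ‖1 + ρ * omg‖)
    (n1 : F ≠ 1 + ρ * omg) (n2 : F ≠ -1 - omg + ρ * omg)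
    (t1 : 0 < turn 1 (1 + ρ * omg) F) (t2 : 0 < turn (1 + ρ * omg) F (-1 - omg + ρ * omg))
    (t3 : 0 < turn F (-1 - omg + ρ * omg) (-1 - omg)) : 0 ≤ (F / (1 + ρ * omg)).im := by
  have q := sq3
  have hw : conj omg * omg = 1 := by
    apply Complex.ext <;> simp [omg_re, omg_im] <;> nlinarith
  obtain ⟨G, rfl⟩ : ∃ G, F = omg * G := ⟨conj omg * F, by rw [← mul_assoc, mul_comm omg, hw, one_mul]⟩
  have hE : (1 + ρ * omg) = omg * (⟨ρ - 1/2, -(√3/2)⟩ : ℂ) := by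
    apply Complex.ext <;> simp [omg_re, omg_im] <;> nlinarith
  have hE2 : (-1 - omg + ρ * omg) = omg * (⟨ρ - 1/2, √3/2⟩ : ℂ) := by
    apply Complex.ext <;> simp [omg_re, omg_im] <;> nlinarith
  have hC : (1 : ℂ) = omg * (⟨- 1/2, -(√3/2)⟩ : ℂ) := by
    apply Complex.ext <;> simp [omg_re, omg_im] <;> nlinarith
  have hC2 : (-1 - omg) = omg * (⟨- 1/2, √3/2⟩ : ℂ) := by
    apply Complex.ext <;> simp [omg_re, omg_im] <;> nlinarith
  have hom : omg ≠ 0 := by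
    intro h; rw [h] at hw; simp at hw
  have key (x y z : ℂ) (h : 0 < turn (omg * x) (omg * y) (omg * z)) :
      0 ≤ (conj (y - x) * (z - y)).im := by
    have := turn_affine 0 omg x y z hom
    simp only [zero_add] at this
    rw [this] at h
    exact turn_pos_im h
  rw [hE2] at n2 t2 t3
  rw [hE] at hN n1 t1 t2 ⊢
  rw [hC2] at t3
  have t1' := key ⟨- 1/2, -(√3/2)⟩ ⟨ρ - 1/2, -(√3/2)⟩ G (by rw [← hC]; exact t1)
  have t2' := key _ _ _ t2
  have t3' := key _ _ _ t3
  simp at t1' t2' t3'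
  have s0 : 0 < √3/2 := by positivity
  have hN2 : G.re^2 + G.im^2 = (ρ - 1/2)^2 + (√3/2)^2 := by
    rw [norm_mul, norm_mul] at hN
    have := mul_left_cancel₀ (norm_ne_zero_iff.2 hom) hN
    have h2 := congrArg (· ^ 2) this
    simp only [← Complex.normSq_eq_norm_sq, Complex.normSq_apply] at h2
    linarith
  have a1 : -(√3/2) ≤ G.im := by
    by_contra hcon
    nlinarith
  have a2 : G.im ≤ √3/2 := by
    by_contra hcon
    nlinarith
  have a3 : ρ - 1/2 ≤ G.re := by
    by_contra hcon
    nlinarith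
  have fin := real_ineq s0 hN2 a1 a2 a3 (fun h => n2 (by congr 1; exact Complex.ext h.1 h.2))
    (fun h => n1 (by congr 1; exact Complex.ext h.1 h.2))
  rw [mul_div_mul_left _ _ hom, Complex.div_im]
  rw [← sub_div]
  apply div_nonneg _ (Complex.normSq_nonneg _)
  simp only []
  linarith

lemma two_data {a c1 d c2 : ℂ} (H : Is2Special a c1 d c2) :
    c1 ≠ a ∧ c2 = a + (c1 - a) * (-1 - omg) ∧
    ∃ g : ℂ, ‖g‖ = 1 ∧ g ≠ 1 ∧ 0 ≤ g.im ∧ d = a + (c1 - a) * g := by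
  obtain ⟨⟨hne, -, -⟩, -, i0, i1, -, -, d1, d2⟩ := H
  have hc : a ≠ c1 := hne 0
  have hcd : c1 ≠ d := hne 1
  change π - turn c2 a c1 = _ at i0
  change π - turn a c1 d < _ at i1
  have hS : c1 - a ≠ 0 := sub_ne_zero.2 hc.symm
  obtain ⟨g, hg⟩ : ∃ z, d = a + (c1 - a) * z := ⟨(d - a) / (c1 - a), by field_simp; ring⟩
  refine ⟨hc.symm, locate_c2 hc.symm (by linarith) (d1.trans d2), g, ?_, ?_, ?_, hg⟩
  · rw [dist_comm, Complex.dist_eq, dist_comm, Complex.dist_eq, hg] at d1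
    have : ‖c1 - a‖ * ‖g‖ = ‖c1 - a‖ * 1 := by rw [← norm_mul, mul_one, d1]; congr 1; ring
    exact mul_left_cancel₀ (norm_ne_zero_iff.2 hS) this
  · rintro rfl
    apply hcd; rw [hg]; ring
  · have t : 0 < turn 0 1 g := by
      rw [← turn_affine a (c1 - a) 0 1 g hS, ← hg]
      rw [mul_zero, add_zero, mul_one, add_sub_cancel]; linarith
    have := turn_pos_im t
    simpa using this

/-- In a 3-special polygon, `e''` plays the role of `f'`. -/
lemma three_data {a c1 e1 e2 c2 : ℂ} (H : Is3Special a c1 e1 e2 c2) :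
    c1 ≠ a ∧ ∃ ρ : ℝ, 0 < ρ ∧ e1 = a + (c1 - a) * (1 + ρ * omg) ∧
      c2 = a + (c1 - a) * (-1 - omg) ∧ e2 = a + (c1 - a) * (-1 - omg + ρ * omg) ∧
      1 / 2 ≤ ρ := by
  obtain ⟨⟨hne, -, hdis⟩, -, i0, -, i1, i4, d1, -, d2, -, -⟩ := H
  have hc : a ≠ c1 := hne 0
  have hce : c1 ≠ e1 := hne 1
  change π - turn c2 a c1 = _ at i0
  change π - turn a c1 e1 = _ at i1
  change π - turn e2 c2 a = _ at i4
  obtain ⟨ρ, h0, h1, h2, h3⟩ := base hc.symm hce (by linarith) (by linarith) (by linarith) d1 d2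
  refine ⟨hc.symm, ρ, h0, h1, h2, h3, ?_⟩
  by_contra hcon
  push Not at hcon
  have hd : segment ℝ a c1 ∩ segment ℝ e1 e2 = ∅ :=
    hdis 0 2 (by decide) (by decide) (by decide)
  have : a + (1 - 2 * ρ) * (c1 - a) ∈ segment ℝ a c1 ∩ segment ℝ e1 e2 := by
    constructor
    · refine ⟨2 * ρ, 1 - 2 * ρ, by linarith, by linarith, by ring, ?_⟩
      simp only [Complex.real_smul]; push_cast; ring
    · refine ⟨1 - ρ, ρ, by linarith, by linarith, by ring, ?_⟩
      rw [h1, h3]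
      simp only [Complex.real_smul]; push_cast; ring
  rw [hd] at this
  exact this

lemma four_data {a c1 e1 f e2 c2 : ℂ} (H : Is4Special a c1 e1 f e2 c2) :
    c1 ≠ a ∧ ∃ ρ : ℝ, 0 < ρ ∧ e1 = a + (c1 - a) * (1 + ρ * omg) ∧
      c2 = a + (c1 - a) * (-1 - omg) ∧ e2 = a + (c1 - a) * (-1 - omg + ρ * omg) ∧
      f ≠ e2 ∧ ∃ g : ℂ, ‖g‖ = 1 ∧ g ≠ 1 ∧ 0 ≤ g.im ∧ f = a + (e1 - a) * g := by
  obtain ⟨⟨hne, -, -⟩, -, i0, iall, i1, i5, d1, -, d2, d3, d4⟩ := H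
  have hc : a ≠ c1 := hne 0
  have hce : c1 ≠ e1 := hne 1
  have hef : e1 ≠ f := hne 2
  have hfe : f ≠ e2 := hne 3
  have j2 : π - turn c1 e1 f < π := iall 2 (by decide)
  have j3 : π - turn e1 f e2 < π := iall 3 (by decide)
  have j4 : π - turn f e2 c2 < π := iall 4 (by decide)
  change π - turn c2 a c1 = _ at i0
  change π - turn a c1 e1 = _ at i1
  change π - turn e2 c2 a = _ at i5
  obtain ⟨ρ, h0, h1, h2, h3⟩ := base hc.symm hce (by linarith) (by linarith) (by linarith) d1 d2
  have hS : c1 - a ≠ 0 := sub_ne_zero.2 hc.symm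
  refine ⟨hc.symm, ρ, h0, h1, h2, h3, hfe, ?_⟩
  obtain ⟨F, hF⟩ : ∃ z, f = a + (c1 - a) * z := ⟨(f - a) / (c1 - a), by field_simp; ring⟩
  have x1 : c1 = a + (c1 - a) * 1 := by ring
  have hE := E_ne h0
  have hN : ‖F‖ = ‖1 + ρ * omg‖ := by
    rw [dist_comm, Complex.dist_eq, dist_comm, Complex.dist_eq, hF, h1] at d3
    rw [add_sub_cancel_left, add_sub_cancel_left, norm_mul, norm_mul] at d3
    exact (mul_left_cancel₀ (norm_ne_zero_iff.2 hS) d3).symm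
  have n1 : F ≠ 1 + ρ * omg := by rintro rfl; exact hef (h1.trans hF.symm)
  have n2 : F ≠ -1 - omg + ρ * omg := by rintro rfl; exact hfe (hF.trans h3.symm)
  have t1 : 0 < turn 1 (1 + ρ * omg) F := by
    rw [← turn_affine a (c1 - a) _ _ _ hS, ← hF, ← h1, ← x1]; linarith
  have t2 : 0 < turn (1 + ρ * omg) F (-1 - omg + ρ * omg) := by
    rw [← turn_affine a (c1 - a) _ _ _ hS, ← hF, ← h1, ← h3]; linarith
  have t3 : 0 < turn F (-1 - omg + ρ * omg) (-1 - omg) := by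
    rw [← turn_affine a (c1 - a) _ _ _ hS, ← hF, ← h2, ← h3]; linarith
  refine ⟨F / (1 + ρ * omg), ?_, ?_, f_side h0 hN n1 n2 t1 t2 t3, ?_⟩
  · rw [norm_div, hN, div_self (norm_ne_zero_iff.2 hE)]
  · intro h; rw [div_eq_one_iff_eq hE] at h; exact n1 h
  · rw [hF, h1]; field_simp; ring

lemma three_g {ρ : ℝ} (h0 : 1 / 2 ≤ ρ) : ∃ g : ℂ, ‖g‖ = 1 ∧ g ≠ 1 ∧ 0 ≤ g.im ∧
    (-1 - omg + ρ * omg) = (1 + ρ * omg) * g := by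
  have hE := E_ne (ρ := ρ) (by linarith)
  refine ⟨(-1 - omg + ρ * omg) / (1 + ρ * omg), ?_, ?_, ?_, ?_⟩
  · rw [norm_div, norm_E2, div_self (norm_ne_zero_iff.2 hE)]
  · intro h; rw [div_eq_one_iff_eq hE] at h
    have := congrArg Complex.im h
    simp [omg_im] at this
  · rw [Complex.div_im, ← sub_div]
    apply div_nonneg _ (Complex.normSq_nonneg _)
    simp [omg_re, omg_im]
    have h3 : 0 < √3 := by positivity
    nlinarith
  · rw [mul_div_cancel₀ _ hE]

lemma three_four {a c1 e1 e2 c2 b c1' e1' f e2' c2' : ℂ} (H : Is3Special a c1 e1 e2 c2)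
    (K : Is4Special b c1' e1' f e2' c2')
    (hφ : EuclideanGeometry.angle c1 a e1 = EuclideanGeometry.angle c1' b e1')
    (hα : EuclideanGeometry.angle a e1 e2 = EuclideanGeometry.angle b e1' f) : False := by
  obtain ⟨hc, ρ, h0, h1, h2, h3, h4⟩ := three_data H
  obtain ⟨kc, ρ', k0, k1, k2, k3, k4, g, k5, k6, k7, k8⟩ := four_data K
  have hρ : ρ = ρ' := by
    rw [h1, k1, phi_eq hc h0, phi_eq kc k0] at hφ
    exact rho_unique h0 k0 hφ
  subst hρ
  obtain ⟨g', g1, g2, g3, g4⟩ := three_g h4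
  have he : e2 = a + (e1 - a) * g' := by rw [h3, g4, h1]; ring
  have hn : e1 ≠ a := by
    rw [h1]; simpa using ⟨sub_ne_zero.2 hc, E_ne h0⟩
  have kn : e1' ≠ b := by
    rw [k1]; simpa using ⟨sub_ne_zero.2 kc, E_ne k0⟩
  rw [he, k8] at hα
  have := g_unique hn kn g1 g2 k5 k6 g3 k7 hα
  subst this
  apply k4
  rw [k8, k3, g4, k1]; ring

/-- If two special polygons (each 2-, 3- or 4-special, not necessarily a
priori of the same type) have the same angle parameters `φ` and `α`, then they
are of the same type (same number of vertices) and directly similar: an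
orientation-preserving similarity `z ↦ s·z + t` of the plane, `s ≠ 0`, carries
the labeled vertices of one to the correspondingly labeled vertices of the
other. -/
theorem special_polygon_same_parameters_similar (P Q : SpecialPolygon)
    (hφ : P.phi = Q.phi) (hα : P.alpha = Q.alpha) :
    P.vertices.length = Q.vertices.length ∧
      ∃ s t : ℂ, s ≠ 0 ∧ P.vertices.map (fun z => s * z + t) = Q.vertices := by
  rcases P with ⟨a, c1, d, c2, H⟩ | ⟨a, c1, e1, e2, c2, H⟩ | ⟨a, c1, e1, f, e2, c2, H⟩ <;>
  rcases Q with ⟨b, b1, d', b2, K⟩ | ⟨b, b1, x1, x2, b2, K⟩ | ⟨b, b1, x1, f', x2, b2, K⟩ <;>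
  simp only [SpecialPolygon.phi, SpecialPolygon.alpha] at hφ hα
  · obtain ⟨hc, h1, g, h2, h3, h4, h5⟩ := two_data H
    obtain ⟨kc, k1, g', k2, k3, k4, k5⟩ := two_data K
    rw [h5, k5] at hα
    have hg := g_unique hc kc h2 h3 k2 k3 h4 k4 hα
    subst hg
    have hS : c1 - a ≠ 0 := sub_ne_zero.2 hc
    have kS : b1 - b ≠ 0 := sub_ne_zero.2 kc
    refine ⟨rfl, (b1 - b) / (c1 - a), b - (b1 - b) / (c1 - a) * a, div_ne_zero kS hS, ?_⟩
    simp only [SpecialPolygon.vertices, List.map_cons, List.map_nil, List.cons.injEq, and_true]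
    rw [h1, h5, k1, k5]
    refine ⟨?_, ?_, ?_, ?_⟩ <;> field_simp <;> ring
  · obtain ⟨kc, ρ', k0, k1, -⟩ := three_data K
    rw [k1, phi_eq kc k0] at hφ
    exact absurd hφ.symm (phi_ne_zero k0)
  · obtain ⟨kc, ρ', k0, k1, -⟩ := four_data K
    rw [k1, phi_eq kc k0] at hφ
    exact absurd hφ.symm (phi_ne_zero k0)
  · obtain ⟨kc, ρ', k0, k1, -⟩ := three_data H
    rw [k1, phi_eq kc k0] at hφ
    exact absurd hφ (phi_ne_zero k0)
  · obtain ⟨hc, ρ, h0, h1, h2, h3, -⟩ := three_data H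
    obtain ⟨kc, ρ', k0, k1, k2, k3, -⟩ := three_data K
    have hρ : ρ = ρ' := by
      rw [h1, k1, phi_eq hc h0, phi_eq kc k0] at hφ
      exact rho_unique h0 k0 hφ
    subst hρ
    have hS : c1 - a ≠ 0 := sub_ne_zero.2 hc
    have kS : b1 - b ≠ 0 := sub_ne_zero.2 kc
    refine ⟨rfl, (b1 - b) / (c1 - a), b - (b1 - b) / (c1 - a) * a, div_ne_zero kS hS, ?_⟩
    simp only [SpecialPolygon.vertices, List.map_cons, List.map_nil, List.cons.injEq, and_true]
    rw [h1, h2, h3, k1, k2, k3]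
    refine ⟨?_, ?_, ?_, ?_, ?_⟩ <;> field_simp <;> ring
  · exact (three_four H K hφ hα).elim
  · obtain ⟨kc, ρ', k0, k1, -⟩ := four_data H
    rw [k1, phi_eq kc k0] at hφ
    exact absurd hφ (phi_ne_zero k0)
  · exact (three_four K H hφ.symm hα.symm).elim
  · obtain ⟨hc, ρ, h0, h1, h2, h3, -, g, g1, g2, g3, h4⟩ := four_data H
    obtain ⟨kc, ρ', k0, k1, k2, k3, -, g', g1', g2', g3', k4⟩ := four_data K
    have hρ : ρ = ρ' := by
      rw [h1, k1, phi_eq hc h0, phi_eq kc k0] at hφ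
      exact rho_unique h0 k0 hφ
    subst hρ
    have hn : e1 ≠ a := by
      rw [h1]; simpa using ⟨sub_ne_zero.2 hc, E_ne h0⟩
    have kn : x1 ≠ b := by
      rw [k1]; simpa using ⟨sub_ne_zero.2 kc, E_ne k0⟩
    rw [h4, k4] at hα
    have hg := g_unique hn kn g1 g2 g1' g2' g3 g3' hα
    subst hg
    have hS : c1 - a ≠ 0 := sub_ne_zero.2 hc
    have kS : b1 - b ≠ 0 := sub_ne_zero.2 kc
    refine ⟨rfl, (b1 - b) / (c1 - a), b - (b1 - b) / (c1 - a) * a, div_ne_zero kS hS, ?_⟩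
    simp only [SpecialPolygon.vertices, List.map_cons, List.map_nil, List.cons.injEq, and_true]
    rw [h4, k4, h1, h2, h3, k1, k2, k3]
    refine ⟨?_, ?_, ?_, ?_, ?_, ?_⟩ <;> field_simp <;> ring
end

section
/- Let Y = {(φ,α) ∈ ℝ² : 0 ≤ φ < 2π/3, 0 < α ≤ π/2, and φ − π/6 ≤ α < φ + π/3}. Then for every (φ,α) ∈ Y with α ≠ π/2, there exists a special polygon P (2-, 3- or 4-special) whose angle parameters are φ(P) = φ and α(P) = α. In other words, the image of the angle-parameter map on special polygons is exactly the set {(φ,α) ∈ Y : α ≠ π/2}. -/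
open Real EuclideanGeometry

attribute [local instance] Complex.finrank_real_complex_fact

noncomputable def cis (t : ℝ) : ℂ := ⟨Real.cos t, Real.sin t⟩

lemma cis_re (t : ℝ) : (cis t).re = Real.cos t := rfl
lemma cis_im (t : ℝ) : (cis t).im = Real.sin t := rfl

lemma cis_add (s t : ℝ) : cis (s + t) = cis s * cis t := by
  apply Complex.ext
  · simp [cis, Real.cos_add]
  · simp [cis, Real.sin_add]; ring

lemma cis_zero : cis 0 = 1 := by
  apply Complex.ext <;> simp [cis]

lemma cis_pi : cis π = -1 := by
  apply Complex.ext <;> simp [cis]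

lemma cis_add_pi (t : ℝ) : cis (t + π) = - cis t := by
  rw [cis_add, cis_pi]; ring

lemma cis_add_two_pi (t : ℝ) : cis (t + 2 * π) = cis t := by
  apply Complex.ext <;> simp [cis]

lemma cis_norm (t : ℝ) : ‖cis t‖ = 1 := by
  rw [Complex.norm_def, Complex.normSq_apply, cis_re, cis_im]
  rw [show Real.cos t * Real.cos t + Real.sin t * Real.sin t = 1 by
    nlinarith [Real.sin_sq_add_cos_sq t]]
  simp

lemma cis_ne (t : ℝ) : cis t ≠ 0 := by
  intro h
  have := cis_norm t
  rw [h] at this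
  simp at this

lemma cis_conj (t : ℝ) : (starRingEnd ℂ) (cis t) = cis (-t) := by
  apply Complex.ext <;> simp [cis]

lemma arg_polar (r t : ℝ) (hr : 0 < r) (h1 : -π < t) (h2 : t ≤ π) :
    Complex.arg ((r : ℂ) * cis t) = t := by
  have := Complex.arg_mul_cos_add_sin_mul_I hr (θ := t) ⟨h1, h2⟩
  have e : cis t = Complex.cos t + Complex.sin t * Complex.I := by
    apply Complex.ext <;> simp [cis, Complex.cos_ofReal_re, Complex.sin_ofReal_re]
  rw [e, this]

lemma polar_form (z : ℂ) : z = (‖z‖ : ℂ) * cis (Complex.arg z) := by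
  conv_lhs => rw [← Complex.norm_mul_cos_add_sin_mul_I z]
  congr 1
  apply Complex.ext <;> simp [cis, Complex.cos_ofReal_re, Complex.sin_ofReal_re]

lemma turn_eq (p q r : ℂ) : turn p q r = Complex.arg ((starRingEnd ℂ) (q - p) * (r - q)) := by
  unfold turn
  rw [Complex.oangle]
  exact Complex.arg_coe_angle_toReal_eq_arg _

lemma turn_polar {p q r w : ℂ} {r1 b1 r2 b2 : ℝ} (hw : w ≠ 0)
    (h1 : q - p = w * (r1 * cis b1)) (h2 : r - q = w * (r2 * cis b2))
    (hr1 : 0 < r1) (hr2 : 0 < r2) (hb : -π < b2 - b1) (hb' : b2 - b1 ≤ π) :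
    turn p q r = b2 - b1 := by
  rw [turn_eq, h1, h2]
  have : (starRingEnd ℂ) (w * (r1 * cis b1)) * (w * (r2 * cis b2)) =
      ((Complex.normSq w * r1 * r2 : ℝ) : ℂ) * cis (b2 - b1) := by
    rw [map_mul, map_mul, cis_conj, Complex.conj_ofReal, sub_eq_add_neg, cis_add]
    push_cast
    rw [Complex.normSq_eq_conj_mul_self]
    ring
  rw [this]
  have := Complex.normSq_pos.2 hw
  exact arg_polar _ _ (by positivity) hb hb'

lemma turn_inv {p q r : ℂ} (hp : p ≠ q) (hr : q ≠ r) :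
    ∃ l : ℝ, 0 < l ∧ r - q = (q - p) * (l * cis (turn p q r)) := by
  have h1 : q - p ≠ 0 := sub_ne_zero.2 hp.symm
  have h2 : r - q ≠ 0 := sub_ne_zero.2 hr.symm
  have hn := Complex.normSq_pos.2 h1
  refine ⟨‖(starRingEnd ℂ) (q - p) * (r - q)‖ / Complex.normSq (q - p), ?_, ?_⟩
  · apply div_pos _ hn
    rw [norm_pos_iff]
    exact mul_ne_zero ((map_ne_zero _).2 h1) h2
  · rw [turn_eq]
    have := polar_form ((starRingEnd ℂ) (q - p) * (r - q))
    have h3 : ((Complex.normSq (q - p) : ℝ) : ℂ) ≠ 0 := by exact_mod_cast hn.ne'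
    push_cast
    have h4 := Complex.normSq_eq_conj_mul_self (z := q - p)
    rw [div_mul_eq_mul_div, mul_div_assoc', eq_div_iff h3]
    rw [← this, h4]
    ring

lemma angle_turn {p q r : ℂ} (hp : p ≠ q) (hr : q ≠ r) :
    EuclideanGeometry.angle p q r = π - |turn p q r| := by
  have h1 : q - p ≠ 0 := sub_ne_zero.2 hp.symm
  have h2 : r - q ≠ 0 := sub_ne_zero.2 hr.symm
  unfold EuclideanGeometry.angle turn
  rw [← Complex.orientation.angle_eq_abs_oangle_toReal h1 h2]
  rw [vsub_eq_sub, vsub_eq_sub, ← neg_sub q p, InnerProductGeometry.angle_neg_left]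

lemma angle_polar {p q r w : ℂ} {r1 b1 r2 b2 : ℝ} (hw : w ≠ 0)
    (h1 : p - q = w * (r1 * cis b1)) (h2 : r - q = w * (r2 * cis b2))
    (hr1 : 0 < r1) (hr2 : 0 < r2) (hb : 0 < b2 - b1) (hb' : b2 - b1 < π) :
    EuclideanGeometry.angle p q r = b2 - b1 := by
  have e1 : p ≠ q := by
    rw [← sub_ne_zero, h1]
    exact mul_ne_zero hw (mul_ne_zero (by exact_mod_cast hr1.ne') (cis_ne _))
  have e2 : r ≠ q := by
    rw [← sub_ne_zero, h2]
    exact mul_ne_zero hw (mul_ne_zero (by exact_mod_cast hr2.ne') (cis_ne _))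
  rw [angle_turn e1 e2.symm]
  have : turn p q r = b2 - (b1 + π) := by
    apply turn_polar hw _ h2 hr1 hr2 <;> try linarith
    rw [cis_add_pi, ← neg_sub, h1]; ring
  rw [this, abs_of_nonpos (by linarith)]
  ring

lemma chord (R a b : ℝ) : (R : ℂ) * cis b - R * cis a =
    ((2 * R * Real.sin ((b - a) / 2) : ℝ) : ℂ) * cis ((a + b) / 2 + π / 2) := by
  have e1 : b = (a + b) / 2 + (b - a) / 2 := by ring
  have e2 : a = (a + b) / 2 - (b - a) / 2 := by ring
  apply Complex.ext
  · simp only [Complex.sub_re, Complex.mul_re, Complex.ofReal_re, Complex.ofReal_im, cis_re, cis_im,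
      Real.cos_add_pi_div_two]
    have c1 : Real.cos b = Real.cos ((a + b) / 2 + (b - a) / 2) := by rw [← e1]
    have c2 : Real.cos a = Real.cos ((a + b) / 2 - (b - a) / 2) := by rw [← e2]
    rw [c1, c2, Real.cos_add, Real.cos_sub]
    ring
  · simp only [Complex.sub_im, Complex.mul_im, Complex.ofReal_re, Complex.ofReal_im, cis_re, cis_im,
      Real.sin_add_pi_div_two]
    have c1 : Real.sin b = Real.sin ((a + b) / 2 + (b - a) / 2) := by rw [← e1]
    have c2 : Real.sin a = Real.sin ((a + b) / 2 - (b - a) / 2) := by rw [← e2]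
    rw [c1, c2, Real.sin_add, Real.sin_sub]
    ring

lemma tri1 (β φ : ℝ) : ((Real.sin β : ℝ) : ℂ) * cis φ - (Real.sin (β - φ) : ℝ) =
    (Real.sin φ : ℝ) * cis β := by
  apply Complex.ext
  · simp only [Complex.sub_re, Complex.mul_re, Complex.ofReal_re, Complex.ofReal_im, cis_re, cis_im,
      Real.sin_sub]
    ring
  · simp only [Complex.sub_im, Complex.mul_im, Complex.ofReal_re, Complex.ofReal_im, cis_re, cis_im]
    ring

lemma tri2 (β φ γ : ℝ) : ((Real.sin (β - φ) : ℝ) : ℂ) * cis γ - (Real.sin β : ℝ) * cis (γ - φ) =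
    (Real.sin φ : ℝ) * cis (γ - β + π) := by
  have h := congrArg (starRingEnd ℂ) (tri1 β φ)
  simp only [map_sub, map_mul, Complex.conj_ofReal, cis_conj] at h
  rw [cis_add_pi, sub_eq_add_neg γ φ, sub_eq_add_neg γ β, cis_add, cis_add]
  linear_combination (- cis γ) * h

/-- points of a segment between two polar points -/
lemma seg_polar {r1 r2 t1 t2 : ℝ} (hr1 : 0 < r1) (hr2 : 0 < r2) (h : t1 < t2) (h' : t2 < t1 + π)
    {z : ℂ} (hz : z ∈ segment ℝ ((r1 : ℂ) * cis t1) ((r2 : ℂ) * cis t2)) :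
    ∃ r t : ℝ, 0 < r ∧ t1 ≤ t ∧ t ≤ t2 ∧ z = r * cis t ∧
      (t = t1 → z = r1 * cis t1) ∧ (t = t2 → z = r2 * cis t2) := by
  obtain ⟨u, v, hu, hv, huv, rfl⟩ := hz
  rcases hu.eq_or_lt with rfl | hu
  · have : v = 1 := by linarith
    subst this
    exact ⟨r2, t2, hr2, h.le, le_rfl, by simp, fun e => absurd e h.ne', by simp⟩
  rcases hv.eq_or_lt with rfl | hv
  · have : u = 1 := by linarith
    subst this
    exact ⟨r1, t1, hr1, le_rfl, h.le, by simp, by simp, fun e => absurd e h.ne⟩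
  set W : ℂ := (u * r1 : ℝ) + (v * r2 : ℝ) * cis (t2 - t1) with hW
  have hz : u • ((r1 : ℂ) * cis t1) + v • ((r2 : ℂ) * cis t2) = W * cis t1 := by
    rw [hW, show t2 = (t2 - t1) + t1 by ring, cis_add]
    simp only [Complex.real_smul, add_sub_cancel_right]
    push_cast
    ring
  have hs : 0 < Real.sin (t2 - t1) := Real.sin_pos_of_pos_of_lt_pi (by linarith) (by linarith)
  have him : 0 < W.im := by
    simp [hW, cis]; positivity
  have hW0 : 0 < ‖W‖ := by
    rw [norm_pos_iff]; intro h0; rw [h0] at him; simp at him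
  have hpol := polar_form W
  have ha0 : 0 < Complex.arg W := by
    rcases (Complex.arg_nonneg_iff.2 him.le).eq_or_lt with h0 | h0
    · rw [← h0, cis_zero] at hpol
      rw [hpol] at him; simp at him
    · exact h0
  have hapi := Complex.arg_le_pi W
  have ha2 : Complex.arg W < t2 - t1 := by
    have e : W * cis (-(t2 - t1)) = (‖W‖ : ℂ) * cis (Complex.arg W - (t2 - t1)) := by
      conv_lhs => rw [hpol]
      rw [sub_eq_add_neg (Complex.arg W), cis_add]; ring
    have e2 : (W * cis (-(t2 - t1))).im = - (u * r1 * Real.sin (t2 - t1)) := by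
      rw [hW, add_mul, mul_assoc, ← cis_add, add_neg_cancel, cis_zero]
      simp only [Complex.add_im, Complex.mul_im, Complex.ofReal_re, Complex.ofReal_im, cis_im,
        Real.sin_neg, mul_one]
      ring
    have e3 := congrArg Complex.im e
    rw [e2] at e3
    simp [cis_im] at e3
    by_contra hc
    have : 0 ≤ Real.sin (Complex.arg W - (t2 - t1)) :=
      Real.sin_nonneg_of_nonneg_of_le_pi (by linarith) (by linarith)
    have p1 : 0 < u * r1 * Real.sin (t2 - t1) := by positivity
    have p2 : 0 ≤ ‖W‖ * Real.sin (Complex.arg W - (t2 - t1)) := by positivity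
    linarith
  refine ⟨‖W‖, Complex.arg W + t1, hW0, by linarith, by linarith, ?_, ?_, ?_⟩
  · rw [hz, cis_add, ← mul_assoc, ← hpol]
  · intro e; exfalso; linarith
  · intro e; exfalso; linarith

lemma polar_unique {r s t u : ℝ} (hr : 0 < r) (hs : 0 < s) (h : (r : ℂ) * cis t = s * cis u)
    (h1 : t - u < 2 * π) (h2 : u - t < 2 * π) : t = u := by
  have hn := congrArg (fun z : ℂ => ‖z‖) h
  simp only [norm_mul, cis_norm, mul_one, Complex.norm_real, Real.norm_eq_abs, abs_of_pos hr,
    abs_of_pos hs] at hn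
  subst hn
  have h3 : cis t = cis u := mul_left_cancel₀ (by exact_mod_cast hr.ne') h
  have h4 : cis (t - u) = 1 := by
    rw [sub_eq_add_neg, cis_add, h3, ← cis_add, add_neg_cancel, cis_zero]
  have h5 : Real.cos (t - u) = 1 := by rw [← cis_re, h4]; simp
  have := (Real.cos_eq_one_iff_of_lt_of_lt (by linarith) h1).1 h5
  linarith

lemma outer_adj {r1 r2 r3 t1 t2 t3 : ℝ} (hr1 : 0 < r1) (hr2 : 0 < r2) (hr3 : 0 < r3)
    (h12 : t1 < t2) (h12' : t2 < t1 + π) (h23 : t2 < t3) (h23' : t3 < t2 + π)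
    (h13 : t3 - t1 < 2 * π) :
    segment ℝ ((r1 : ℂ) * cis t1) ((r2 : ℂ) * cis t2) ∩
      segment ℝ ((r2 : ℂ) * cis t2) ((r3 : ℂ) * cis t3) = {(r2 : ℂ) * cis t2} := by
  apply Set.eq_singleton_iff_unique_mem.2
  refine ⟨⟨right_mem_segment _ _ _, left_mem_segment _ _ _⟩, ?_⟩
  rintro z ⟨hz1, hz2⟩
  obtain ⟨r, t, hr, ha, hb, hz, _, hc⟩ := seg_polar hr1 hr2 h12 h12' hz1
  obtain ⟨s, u, hs, ha', hb', hz', _, hc'⟩ := seg_polar hr2 hr3 h23 h23' hz2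
  have := polar_unique hr hs (hz.symm.trans hz') (by linarith) (by linarith)
  exact hc (by linarith)

lemma outer_disj {r1 r2 r3 r4 t1 t2 t3 t4 : ℝ} (hr1 : 0 < r1) (hr2 : 0 < r2) (hr3 : 0 < r3)
    (hr4 : 0 < r4) (h12 : t1 < t2) (h12' : t2 < t1 + π) (h23 : t2 < t3) (h34 : t3 < t4)
    (h34' : t4 < t3 + π) (h14 : t4 - t1 < 2 * π) :
    segment ℝ ((r1 : ℂ) * cis t1) ((r2 : ℂ) * cis t2) ∩
      segment ℝ ((r3 : ℂ) * cis t3) ((r4 : ℂ) * cis t4) = ∅ := by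
  apply Set.eq_empty_iff_forall_notMem.2
  rintro z ⟨hz1, hz2⟩
  obtain ⟨r, t, hr, ha, hb, hz, _, hc⟩ := seg_polar hr1 hr2 h12 h12' hz1
  obtain ⟨s, u, hs, ha', hb', hz', _, hc'⟩ := seg_polar hr3 hr4 h34 h34' hz2
  have := polar_unique hr hs (hz.symm.trans hz') (by linarith) (by linarith)
  linarith

lemma spoke_mem {z v : ℂ} (h : z ∈ segment ℝ 0 v) : ∃ s : ℝ, 0 ≤ s ∧ s ≤ 1 ∧ z = s * v := by
  obtain ⟨u, s, hu, hs, hus, rfl⟩ := h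
  exact ⟨s, hs, by linarith, by simp⟩

/-- A spoke and an outer segment: a common point has the angle of the spoke. -/
lemma spoke_outer {r r1 r2 t t1 t2 : ℝ} (hr : 0 < r) (hr1 : 0 < r1) (hr2 : 0 < r2)
    (h12 : t1 < t2) (h12' : t2 < t1 + π) (ha : t - t1 < 2 * π) (hb : t2 - t < 2 * π)
    {z : ℂ} (hz1 : z ∈ segment ℝ 0 ((r : ℂ) * cis t))
    (hz2 : z ∈ segment ℝ ((r1 : ℂ) * cis t1) ((r2 : ℂ) * cis t2)) :
    t1 ≤ t ∧ t ≤ t2 ∧ (t = t1 → z = r1 * cis t1) ∧ (t = t2 → z = r2 * cis t2) := by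
  obtain ⟨s, u, hs, ha', hb', hz', hc, hc'⟩ := seg_polar hr1 hr2 h12 h12' hz2
  obtain ⟨k, hk, hk1, hzk⟩ := spoke_mem hz1
  have hz0 : z ≠ 0 := by
    rw [hz']; exact mul_ne_zero (by exact_mod_cast hs.ne') (cis_ne _)
  have hk0 : 0 < k := by
    rcases hk.eq_or_lt with rfl | h
    · exfalso; apply hz0; rw [hzk]; simp
    · exact h
  have e : z = ((k * r : ℝ) : ℂ) * cis t := by rw [hzk]; push_cast; ring
  have := polar_unique (mul_pos hk0 hr) hs (e.symm.trans hz') (by linarith) (by linarith)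
  subst this
  exact ⟨ha', hb', hc, hc'⟩

lemma spoke_first {r1 r2 t1 t2 : ℝ} (hr1 : 0 < r1) (hr2 : 0 < r2)
    (h12 : t1 < t2) (h12' : t2 < t1 + π) :
    segment ℝ 0 ((r1 : ℂ) * cis t1) ∩ segment ℝ ((r1 : ℂ) * cis t1) ((r2 : ℂ) * cis t2) =
      {(r1 : ℂ) * cis t1} := by
  have := Real.pi_pos
  apply Set.eq_singleton_iff_unique_mem.2
  refine ⟨⟨right_mem_segment _ _ _, left_mem_segment _ _ _⟩, ?_⟩
  rintro z ⟨hz1, hz2⟩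
  exact (spoke_outer hr1 hr1 hr2 h12 h12' (by linarith) (by linarith) hz1 hz2).2.2.1 rfl

lemma spoke_last {r1 r2 t1 t2 : ℝ} (hr1 : 0 < r1) (hr2 : 0 < r2)
    (h12 : t1 < t2) (h12' : t2 < t1 + π) :
    segment ℝ ((r1 : ℂ) * cis t1) ((r2 : ℂ) * cis t2) ∩ segment ℝ ((r2 : ℂ) * cis t2) 0 =
      {(r2 : ℂ) * cis t2} := by
  have := Real.pi_pos
  apply Set.eq_singleton_iff_unique_mem.2
  refine ⟨⟨right_mem_segment _ _ _, left_mem_segment _ _ _⟩, ?_⟩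
  rintro z ⟨hz1, hz2⟩
  rw [segment_symm] at hz2
  exact (spoke_outer hr2 hr1 hr2 h12 h12' (by linarith) (by linarith) hz2 hz1).2.2.2 rfl

lemma spoke_disj_first {r r1 r2 t t1 t2 : ℝ} (hr : 0 < r) (hr1 : 0 < r1) (hr2 : 0 < r2)
    (h01 : t < t1) (h12 : t1 < t2) (h12' : t2 < t1 + π) (hb : t2 - t < 2 * π) :
    segment ℝ 0 ((r : ℂ) * cis t) ∩ segment ℝ ((r1 : ℂ) * cis t1) ((r2 : ℂ) * cis t2) = ∅ := by
  have := Real.pi_pos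
  apply Set.eq_empty_iff_forall_notMem.2
  rintro z ⟨hz1, hz2⟩
  have := (spoke_outer hr hr1 hr2 h12 h12' (by linarith) (by linarith) hz1 hz2).1
  linarith

lemma spoke_disj_last {r r1 r2 t t1 t2 : ℝ} (hr : 0 < r) (hr1 : 0 < r1) (hr2 : 0 < r2)
    (h2 : t2 < t) (h12 : t1 < t2) (h12' : t2 < t1 + π) (hb : t - t1 < 2 * π) :
    segment ℝ ((r1 : ℂ) * cis t1) ((r2 : ℂ) * cis t2) ∩ segment ℝ ((r : ℂ) * cis t) 0 = ∅ := by
  have := Real.pi_pos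
  apply Set.eq_empty_iff_forall_notMem.2
  rintro z ⟨hz1, hz2⟩
  rw [segment_symm] at hz2
  have := (spoke_outer hr hr1 hr2 h12 h12' (by linarith) (by linarith) hz2 hz1).2.1
  linarith

lemma spoke_spoke {r1 r2 t1 t2 : ℝ} (hr1 : 0 < r1) (hr2 : 0 < r2)
    (h12 : t1 < t2) (h12' : t2 - t1 < 2 * π) :
    segment ℝ ((r2 : ℂ) * cis t2) 0 ∩ segment ℝ 0 ((r1 : ℂ) * cis t1) = {(0 : ℂ)} := by
  have := Real.pi_pos
  apply Set.eq_singleton_iff_unique_mem.2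
  refine ⟨⟨right_mem_segment _ _ _, left_mem_segment _ _ _⟩, ?_⟩
  rintro z ⟨hz2, hz1⟩
  rw [segment_symm] at hz2
  obtain ⟨k, hk, hk1, hzk⟩ := spoke_mem hz1
  obtain ⟨l, hl, hl1, hzl⟩ := spoke_mem hz2
  rcases hk.eq_or_lt with rfl | hk
  · rw [hzk]; simp
  rcases hl.eq_or_lt with rfl | hl
  · rw [hzl]; simp
  exfalso
  have e : z = ((k * r1 : ℝ) : ℂ) * cis t1 := by rw [hzk]; push_cast; ring
  have e' : z = ((l * r2 : ℝ) : ℂ) * cis t2 := by rw [hzl]; push_cast; ring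
  have := polar_unique (mul_pos hk hr1) (mul_pos hl hr2) (e.symm.trans e')
    (by linarith) (by linarith)
  linarith

lemma pol_ne_zero {r t : ℝ} (hr : 0 < r) : (r : ℂ) * cis t ≠ 0 :=
  mul_ne_zero (by exact_mod_cast hr.ne') (cis_ne _)

lemma pol_ne {r1 r2 t1 t2 : ℝ} (hr1 : 0 < r1) (hr2 : 0 < r2)
    (h12 : t1 < t2) (h12' : t2 < t1 + π) : (r1 : ℂ) * cis t1 ≠ r2 * cis t2 := by
  have := Real.pi_pos
  intro h
  have := polar_unique hr1 hr2 h (by linarith) (by linarith)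
  linarith

lemma simple4 {r1 r2 r3 t1 t2 t3 : ℝ} (hr1 : 0 < r1) (hr2 : 0 < r2) (hr3 : 0 < r3)
    (h12 : t1 < t2) (h12' : t2 < t1 + π) (h23 : t2 < t3) (h23' : t3 < t2 + π)
    (hl : t3 - t1 < 2 * π) :
    IsSimplePolygon ![0, (r1 : ℂ) * cis t1, (r2 : ℂ) * cis t2, (r3 : ℂ) * cis t3] := by
  have H02 := spoke_disj_first hr1 hr2 hr3 h12 h23 h23' hl
  have H13 := spoke_disj_last hr3 hr1 hr2 h23 h12 h12' hl
  refine ⟨?_, ?_, ?_⟩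
  · intro i
    fin_cases i
    · exact (pol_ne_zero hr1).symm
    · exact pol_ne hr1 hr2 h12 h12'
    · exact pol_ne hr2 hr3 h23 h23'
    · exact pol_ne_zero hr3
  · intro i
    fin_cases i
    · exact spoke_first hr1 hr2 h12 h12'
    · exact outer_adj hr1 hr2 hr3 h12 h12' h23 h23' hl
    · exact spoke_last hr2 hr3 h23 h23'
    · exact spoke_spoke hr1 hr3 (h12.trans h23) hl
  · intro i j h1 h2 h3
    fin_cases i <;> fin_cases j <;> first
      | exact absurd rfl h1
      | exact absurd rfl h2
      | exact absurd rfl h3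
      | exact H02
      | exact H13
      | exact (Set.inter_comm _ _).trans H02
      | exact (Set.inter_comm _ _).trans H13

lemma simple5 {r1 r2 r3 r4 t1 t2 t3 t4 : ℝ} (hr1 : 0 < r1) (hr2 : 0 < r2) (hr3 : 0 < r3)
    (hr4 : 0 < r4) (h12 : t1 < t2) (h12' : t2 < t1 + π) (h23 : t2 < t3) (h23' : t3 < t2 + π)
    (h34 : t3 < t4) (h34' : t4 < t3 + π) (hl : t4 - t1 < 2 * π) :
    IsSimplePolygon ![0, (r1 : ℂ) * cis t1, (r2 : ℂ) * cis t2, (r3 : ℂ) * cis t3,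
      (r4 : ℂ) * cis t4] := by
  have H02 := spoke_disj_first hr1 hr2 hr3 h12 h23 h23' (by linarith)
  have H03 := spoke_disj_first hr1 hr3 hr4 (h12.trans h23) h34 h34' hl
  have H13 := outer_disj hr1 hr2 hr3 hr4 h12 h12' h23 h34 h34' hl
  have H14 := spoke_disj_last hr4 hr1 hr2 (h23.trans h34) h12 h12' hl
  have H24 := spoke_disj_last hr4 hr2 hr3 h34 h23 h23' (by linarith)
  refine ⟨?_, ?_, ?_⟩
  · intro i
    fin_cases i
    · exact (pol_ne_zero hr1).symm
    · exact pol_ne hr1 hr2 h12 h12'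
    · exact pol_ne hr2 hr3 h23 h23'
    · exact pol_ne hr3 hr4 h34 h34'
    · exact pol_ne_zero hr4
  · intro i
    fin_cases i
    · exact spoke_first hr1 hr2 h12 h12'
    · exact outer_adj hr1 hr2 hr3 h12 h12' h23 h23' (by linarith)
    · exact outer_adj hr2 hr3 hr4 h23 h23' h34 h34' (by linarith)
    · exact spoke_last hr3 hr4 h34 h34'
    · exact spoke_spoke hr1 hr4 (by linarith) hl
  · intro i j h1 h2 h3
    fin_cases i <;> fin_cases j <;> first
      | exact absurd rfl h1
      | exact absurd rfl h2
      | exact absurd rfl h3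
      | exact H02
      | exact H03
      | exact H13
      | exact H14
      | exact H24
      | exact (Set.inter_comm _ _).trans H02
      | exact (Set.inter_comm _ _).trans H03
      | exact (Set.inter_comm _ _).trans H13
      | exact (Set.inter_comm _ _).trans H14
      | exact (Set.inter_comm _ _).trans H24

lemma simple6 {r1 r2 r3 r4 r5 t1 t2 t3 t4 t5 : ℝ} (hr1 : 0 < r1) (hr2 : 0 < r2) (hr3 : 0 < r3)
    (hr4 : 0 < r4) (hr5 : 0 < r5)
    (h12 : t1 < t2) (h12' : t2 < t1 + π) (h23 : t2 < t3) (h23' : t3 < t2 + π)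
    (h34 : t3 < t4) (h34' : t4 < t3 + π) (h45 : t4 < t5) (h45' : t5 < t4 + π)
    (hl : t5 - t1 < 2 * π) :
    IsSimplePolygon ![0, (r1 : ℂ) * cis t1, (r2 : ℂ) * cis t2, (r3 : ℂ) * cis t3,
      (r4 : ℂ) * cis t4, (r5 : ℂ) * cis t5] := by
  have H02 := spoke_disj_first hr1 hr2 hr3 h12 h23 h23' (by linarith)
  have H03 := spoke_disj_first hr1 hr3 hr4 (h12.trans h23) h34 h34' (by linarith)
  have H04 := spoke_disj_first hr1 hr4 hr5 (by linarith) h45 h45' hl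
  have H13 := outer_disj hr1 hr2 hr3 hr4 h12 h12' h23 h34 h34' (by linarith)
  have H14 := outer_disj hr1 hr2 hr4 hr5 h12 h12' (h23.trans h34) h45 h45' hl
  have H15 := spoke_disj_last hr5 hr1 hr2 (by linarith) h12 h12' hl
  have H24 := outer_disj hr2 hr3 hr4 hr5 h23 h23' h34 h45 h45' (by linarith)
  have H25 := spoke_disj_last hr5 hr2 hr3 (h34.trans h45) h23 h23' (by linarith)
  have H35 := spoke_disj_last hr5 hr3 hr4 h45 h34 h34' (by linarith)
  refine ⟨?_, ?_, ?_⟩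
  · intro i
    fin_cases i
    · exact (pol_ne_zero hr1).symm
    · exact pol_ne hr1 hr2 h12 h12'
    · exact pol_ne hr2 hr3 h23 h23'
    · exact pol_ne hr3 hr4 h34 h34'
    · exact pol_ne hr4 hr5 h45 h45'
    · exact pol_ne_zero hr5
  · intro i
    fin_cases i
    · exact spoke_first hr1 hr2 h12 h12'
    · exact outer_adj hr1 hr2 hr3 h12 h12' h23 h23' (by linarith)
    · exact outer_adj hr2 hr3 hr4 h23 h23' h34 h34' (by linarith)
    · exact outer_adj hr3 hr4 hr5 h34 h34' h45 h45' (by linarith)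
    · exact spoke_last hr4 hr5 h45 h45'
    · exact spoke_spoke hr1 hr5 (by linarith) hl
  · intro i j h1 h2 h3
    fin_cases i <;> fin_cases j <;> first
      | exact absurd rfl h1
      | exact absurd rfl h2
      | exact absurd rfl h3
      | exact H02
      | exact H03
      | exact H04
      | exact H13
      | exact H14
      | exact H15
      | exact H24
      | exact H25
      | exact H35
      | exact (Set.inter_comm _ _).trans H02
      | exact (Set.inter_comm _ _).trans H03
      | exact (Set.inter_comm _ _).trans H04
      | exact (Set.inter_comm _ _).trans H13
      | exact (Set.inter_comm _ _).trans H14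
      | exact (Set.inter_comm _ _).trans H15
      | exact (Set.inter_comm _ _).trans H24
      | exact (Set.inter_comm _ _).trans H25
      | exact (Set.inter_comm _ _).trans H35

lemma exists2 {α : ℝ} (h0 : 0 < α) (h1 : α < π / 3) :
    ∃ P : SpecialPolygon, P.phi = 0 ∧ P.alpha = α := by
  have hpi := Real.pi_pos
  have hone : (0 : ℝ) < 1 := one_pos
  set d1 : ℝ := π - 2 * α with hd1
  have E1 : ((1 : ℝ) : ℂ) * cis 0 - 0 = 1 * (((1 : ℝ) : ℂ) * cis 0) := by ring
  have E2 : ((1 : ℝ) : ℂ) * cis d1 - ((1 : ℝ) : ℂ) * cis 0 =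
      1 * (((2 * 1 * Real.sin ((d1 - 0) / 2) : ℝ) : ℂ) * cis (π - α)) := by
    rw [chord, one_mul]; congr 2; rw [hd1]; ring
  have E3 : ((1 : ℝ) : ℂ) * cis (4 * π / 3) - ((1 : ℝ) : ℂ) * cis d1 =
      1 * (((2 * 1 * Real.sin ((4 * π / 3 - d1) / 2) : ℝ) : ℂ) * cis (5 * π / 3 - α)) := by
    rw [chord, one_mul]; congr 2; rw [hd1]; ring
  have E4 : 0 - ((1 : ℝ) : ℂ) * cis (4 * π / 3) =
      1 * (((1 : ℝ) : ℂ) * cis (4 * π / 3 + π)) := by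
    rw [cis_add_pi]; ring
  have E1' : ((1 : ℝ) : ℂ) * cis 0 - 0 = 1 * (((1 : ℝ) : ℂ) * cis (0 + 2 * π)) := by
    rw [cis_add_two_pi]; ring
  have E0 : 0 - ((1 : ℝ) : ℂ) * cis 0 = 1 * (((1 : ℝ) : ℂ) * cis π) := by
    rw [cis_pi, cis_zero]; ring
  have s2 : 0 < 2 * 1 * Real.sin ((d1 - 0) / 2) := by
    have := Real.sin_pos_of_pos_of_lt_pi (x := (d1 - 0) / 2) (by linarith) (by linarith)
    linarith
  have s3 : 0 < 2 * 1 * Real.sin ((4 * π / 3 - d1) / 2) := by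
    have := Real.sin_pos_of_pos_of_lt_pi (x := (4 * π / 3 - d1) / 2) (by linarith) (by linarith)
    linarith
  have T0 := turn_polar one_ne_zero E4 E1' hone hone (by linarith) (by linarith)
  have T1 := turn_polar one_ne_zero E1 E2 hone s2 (by linarith) (by linarith)
  have T2 := turn_polar one_ne_zero E2 E3 s2 s3 (by linarith) (by linarith)
  have T3 := turn_polar one_ne_zero E3 E4 s3 hone (by linarith) (by linarith)
  refine ⟨.two 0 (((1 : ℝ) : ℂ) * cis 0) (((1 : ℝ) : ℂ) * cis d1)
    (((1 : ℝ) : ℂ) * cis (4 * π / 3)) ⟨?_, ?_, ?_, ?_, ?_, ?_, ?_, ?_⟩, rfl, ?_⟩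
  · exact simple4 hone hone hone (by linarith) (by linarith) (by linarith) (by linarith)
      (by linarith)
  · unfold IsCCW
    rw [Fin.sum_univ_four]
    refine Eq.trans (congrArg₂ _ (congrArg₂ _ (congrArg₂ _ T0 T1) T2) T3) ?_
    ring
  · exact (congrArg (fun x => π - x) T0).trans (by ring)
  · exact (congrArg (fun x => π - x) T1).trans_lt (by linarith)
  · exact (congrArg (fun x => π - x) T3).trans_lt (by linarith)
  · exact (congrArg (fun x => π - x) T2).trans (by ring)
  · simp [dist_eq_norm, cis_norm]
  · simp [dist_eq_norm, cis_norm]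
  · show EuclideanGeometry.angle 0 (((1 : ℝ) : ℂ) * cis 0) (((1 : ℝ) : ℂ) * cis d1) = α
    rw [angle_turn, T1, abs_of_pos (by linarith)]
    · ring
    · exact (pol_ne_zero hone).symm
    · exact pol_ne hone hone (by linarith) (by linarith)

lemma edge1 {a c w : ℂ} {ρ : ℝ} (hc : c = a + w * ρ) :
    c - a = w * ((ρ : ℂ) * cis 0) := by
  rw [hc, cis_zero]; ring

lemma edge1' {a c w : ℂ} {ρ : ℝ} (hc : c = a + w * ρ) :
    c - a = w * ((ρ : ℂ) * cis (2 * π)) := by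
  rw [hc, ← zero_add (2 * π), cis_add_two_pi, cis_zero]; ring

lemma edge2 {a c e w : ℂ} {φ : ℝ} (hc : c = a + w * (Real.sin (2 * π / 3 - φ) : ℝ))
    (he : e = a + w * ((Real.sin (2 * π / 3) : ℝ) * cis φ)) :
    e - c = w * (((Real.sin φ : ℝ) : ℂ) * cis (2 * π / 3)) := by
  rw [hc, he]
  have := tri1 (2 * π / 3) φ
  linear_combination w * this

lemma edge5 {a c e w : ℂ} {φ : ℝ}
    (hc : c = a + w * ((Real.sin (2 * π / 3 - φ) : ℝ) * cis (4 * π / 3)))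
    (he : e = a + w * ((Real.sin (2 * π / 3) : ℝ) * cis (4 * π / 3 - φ))) :
    c - e = w * (((Real.sin φ : ℝ) : ℂ) * cis (5 * π / 3)) := by
  rw [hc, he, show 5 * π / 3 = 4 * π / 3 - 2 * π / 3 + π by ring, ← tri2]; ring

lemma edge6 {a c w : ℂ} {ρ : ℝ} (hc : c = a + w * ((ρ : ℂ) * cis (4 * π / 3))) :
    a - c = w * ((ρ : ℂ) * cis (7 * π / 3)) := by
  rw [hc, show 7 * π / 3 = 4 * π / 3 + π by ring, cis_add_pi]; ring

lemma edgeChord {a e f w : ℂ} {R s t b : ℝ} (he : e = a + w * (R * cis s))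
    (hf : f = a + w * (R * cis t)) (hb : b = (s + t) / 2 + π / 2) :
    f - e = w * (((2 * R * Real.sin ((t - s) / 2) : ℝ) : ℂ) * cis b) := by
  rw [hb, ← chord, he, hf]; ring

lemma edgeBack {a e w : ℂ} {R s : ℝ} (he : e = a + w * (R * cis s)) :
    a - e = w * (R * cis (s + π)) := by
  rw [he, cis_add_pi]; ring

lemma exists3 {φ : ℝ} (h0 : π / 6 < φ) (h1 : φ < 2 * π / 3) :
    ∃ P : SpecialPolygon, P.phi = φ ∧ P.alpha = φ - π / 6 := by
  have hpi := Real.pi_pos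
  have hρ : 0 < Real.sin (2 * π / 3 - φ) := Real.sin_pos_of_pos_of_lt_pi (by linarith) (by linarith)
  have hR : 0 < Real.sin (2 * π / 3) := Real.sin_pos_of_pos_of_lt_pi (by linarith) (by linarith)
  have hφ : 0 < Real.sin φ := Real.sin_pos_of_pos_of_lt_pi (by linarith) (by linarith)
  obtain ⟨c', hc'⟩ : ∃ c' : ℂ, c' = (Real.sin (2 * π / 3 - φ) : ℝ) * cis 0 := ⟨_, rfl⟩
  obtain ⟨e', he'⟩ : ∃ c' : ℂ, c' = (Real.sin (2 * π / 3) : ℝ) * cis φ := ⟨_, rfl⟩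
  obtain ⟨e'', he''⟩ : ∃ c' : ℂ, c' = (Real.sin (2 * π / 3) : ℝ) * cis (4 * π / 3 - φ) := ⟨_, rfl⟩
  obtain ⟨c'', hc''⟩ : ∃ c' : ℂ, c' = (Real.sin (2 * π / 3 - φ) : ℝ) * cis (4 * π / 3) := ⟨_, rfl⟩
  have gc' : c' = 0 + 1 * (Real.sin (2 * π / 3 - φ) : ℝ) := by rw [hc', cis_zero]; ring
  have ge' : e' = 0 + 1 * ((Real.sin (2 * π / 3) : ℝ) * cis φ) := by rw [he']; ring
  have ge'' : e'' = 0 + 1 * ((Real.sin (2 * π / 3) : ℝ) * cis (4 * π / 3 - φ)) := by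
    rw [he'']; ring
  have gc'' : c'' = 0 + 1 * ((Real.sin (2 * π / 3 - φ) : ℝ) * cis (4 * π / 3)) := by
    rw [hc'']; ring
  have E1 := edge1 gc'
  have E1' := edge1' gc'
  have E2 := edge2 gc' ge'
  have E3 := edgeChord (b := 7 * π / 6) ge' ge'' (by ring)
  have E5 := edge5 gc'' ge''
  have E6 := edge6 gc''
  have E0 := edgeBack ge'
  have s3 : 0 < 2 * Real.sin (2 * π / 3) * Real.sin ((4 * π / 3 - φ - φ) / 2) := by
    have := Real.sin_pos_of_pos_of_lt_pi (x := (4 * π / 3 - φ - φ) / 2)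
      (by linarith) (by linarith)
    positivity
  have T0 := turn_polar one_ne_zero E6 E1' hρ hρ (by linarith) (by linarith)
  have T1 := turn_polar one_ne_zero E1 E2 hρ hφ (by linarith) (by linarith)
  have T2 := turn_polar one_ne_zero E2 E3 hφ s3 (by linarith) (by linarith)
  have T3 := turn_polar one_ne_zero E3 E5 s3 hφ (by linarith) (by linarith)
  have T4 := turn_polar one_ne_zero E5 E6 hφ hρ (by linarith) (by linarith)
  have I0 : intAngle ![0, c', e', e'', c''] 0 = 4 * π / 3 :=
    (congrArg (fun x => π - x) T0).trans (by ring)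
  have I1 : intAngle ![0, c', e', e'', c''] 1 = π / 3 :=
    (congrArg (fun x => π - x) T1).trans (by ring)
  have I2 : intAngle ![0, c', e', e'', c''] 2 = π / 2 :=
    (congrArg (fun x => π - x) T2).trans (by ring)
  have I3 : intAngle ![0, c', e', e'', c''] 3 = π / 2 :=
    (congrArg (fun x => π - x) T3).trans (by ring)
  have I4 : intAngle ![0, c', e', e'', c''] 4 = π / 3 :=
    (congrArg (fun x => π - x) T4).trans (by ring)
  refine ⟨.three 0 c' e' e'' c'' ⟨?_, ?_, I0, ?_, I1, I4, ?_, ⟨1, ?_⟩, ?_, I2, I3⟩, ?_, ?_⟩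
  · rw [hc', he', he'', hc'']
    exact simple5 hρ hR hR hρ (by linarith) (by linarith) (by linarith) (by linarith)
      (by linarith) (by linarith) (by linarith)
  · unfold IsCCW
    rw [Fin.sum_univ_five]
    refine Eq.trans (congrArg₂ _ (congrArg₂ _ (congrArg₂ _ (congrArg₂ _ T0 T1) T2) T3) T4) ?_
    ring
  · intro i hi
    fin_cases i
    · exact absurd rfl hi
    · exact I1.trans_lt (by linarith)
    · exact I2.trans_lt (by linarith)
    · exact I3.trans_lt (by linarith)
    · exact I4.trans_lt (by linarith)
  · rw [hc', hc'']; simp [dist_eq_norm, cis_norm]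
  · rw [one_smul, E2, ← neg_sub, E5, show 5 * π / 3 = 2 * π / 3 + π by ring, cis_add_pi]; ring
  · rw [dist_comm, dist_eq_norm, dist_eq_norm, E2, E5]; simp [cis_norm]
  · show EuclideanGeometry.angle c' 0 e' = φ
    have := angle_polar (b2 := φ) one_ne_zero E1
      (show e' - 0 = 1 * ((Real.sin (2 * π / 3) : ℝ) * cis φ) by rw [he']; ring)
      hρ hR (by linarith) (by linarith)
    rw [this]; ring
  · show EuclideanGeometry.angle 0 e' e'' = φ - π / 6
    rw [EuclideanGeometry.angle_comm]
    have := angle_polar one_ne_zero E3 E0 s3 hR (by linarith) (by linarith)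
    rw [this]; ring

lemma exists4 {φ α : ℝ} (h0 : 0 < φ) (h1 : φ < 2 * π / 3) (ha0 : 0 < α) (ha1 : α < π / 2)
    (hl : φ - π / 6 < α) (hu : α < φ + π / 3) :
    ∃ P : SpecialPolygon, P.phi = φ ∧ P.alpha = α := by
  have hpi := Real.pi_pos
  have hρ : 0 < Real.sin (2 * π / 3 - φ) := Real.sin_pos_of_pos_of_lt_pi (by linarith) (by linarith)
  have hR : 0 < Real.sin (2 * π / 3) := Real.sin_pos_of_pos_of_lt_pi (by linarith) (by linarith)
  have hφ : 0 < Real.sin φ := Real.sin_pos_of_pos_of_lt_pi (by linarith) (by linarith)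
  obtain ⟨c', hc'⟩ : ∃ c' : ℂ, c' = (Real.sin (2 * π / 3 - φ) : ℝ) * cis 0 := ⟨_, rfl⟩
  obtain ⟨e', he'⟩ : ∃ c' : ℂ, c' = (Real.sin (2 * π / 3) : ℝ) * cis φ := ⟨_, rfl⟩
  obtain ⟨f', hf'⟩ : ∃ c' : ℂ, c' = (Real.sin (2 * π / 3) : ℝ) * cis (φ + π - 2 * α) := ⟨_, rfl⟩
  obtain ⟨e'', he''⟩ : ∃ c' : ℂ, c' = (Real.sin (2 * π / 3) : ℝ) * cis (4 * π / 3 - φ) := ⟨_, rfl⟩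
  obtain ⟨c'', hc''⟩ : ∃ c' : ℂ, c' = (Real.sin (2 * π / 3 - φ) : ℝ) * cis (4 * π / 3) := ⟨_, rfl⟩
  have gc' : c' = 0 + 1 * (Real.sin (2 * π / 3 - φ) : ℝ) := by rw [hc', cis_zero]; ring
  have ge' : e' = 0 + 1 * ((Real.sin (2 * π / 3) : ℝ) * cis φ) := by rw [he']; ring
  have gf' : f' = 0 + 1 * ((Real.sin (2 * π / 3) : ℝ) * cis (φ + π - 2 * α)) := by rw [hf']; ring
  have ge'' : e'' = 0 + 1 * ((Real.sin (2 * π / 3) : ℝ) * cis (4 * π / 3 - φ)) := by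
    rw [he'']; ring
  have gc'' : c'' = 0 + 1 * ((Real.sin (2 * π / 3 - φ) : ℝ) * cis (4 * π / 3)) := by
    rw [hc'']; ring
  have E1 := edge1 gc'
  have E1' := edge1' gc'
  have E2 := edge2 gc' ge'
  have E3 := edgeChord (b := φ + π - α) ge' gf' (by ring)
  have E4 := edgeChord (b := 5 * π / 3 - α) gf' ge'' (by ring)
  have E5 := edge5 gc'' ge''
  have E6 := edge6 gc''
  have E0 := edgeBack ge'
  have s3 : 0 < 2 * Real.sin (2 * π / 3) * Real.sin ((φ + π - 2 * α - φ) / 2) := by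
    have := Real.sin_pos_of_pos_of_lt_pi (x := (φ + π - 2 * α - φ) / 2)
      (by linarith) (by linarith)
    positivity
  have s4 : 0 < 2 * Real.sin (2 * π / 3) *
      Real.sin ((4 * π / 3 - φ - (φ + π - 2 * α)) / 2) := by
    have := Real.sin_pos_of_pos_of_lt_pi (x := (4 * π / 3 - φ - (φ + π - 2 * α)) / 2)
      (by linarith) (by linarith)
    positivity
  have T0 := turn_polar one_ne_zero E6 E1' hρ hρ (by linarith) (by linarith)
  have T1 := turn_polar one_ne_zero E1 E2 hρ hφ (by linarith) (by linarith)
  have T2 := turn_polar one_ne_zero E2 E3 hφ s3 (by linarith) (by linarith)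
  have T3 := turn_polar one_ne_zero E3 E4 s3 s4 (by linarith) (by linarith)
  have T4 := turn_polar one_ne_zero E4 E5 s4 hφ (by linarith) (by linarith)
  have T5 := turn_polar one_ne_zero E5 E6 hφ hρ (by linarith) (by linarith)
  have I0 : intAngle ![0, c', e', f', e'', c''] 0 = 4 * π / 3 :=
    (congrArg (fun x => π - x) T0).trans (by ring)
  have I1 : intAngle ![0, c', e', f', e'', c''] 1 = π / 3 :=
    (congrArg (fun x => π - x) T1).trans (by ring)
  have I5 : intAngle ![0, c', e', f', e'', c''] 5 = π / 3 :=
    (congrArg (fun x => π - x) T5).trans (by ring)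
  refine ⟨.four 0 c' e' f' e'' c'' ⟨?_, ?_, I0, ?_, I1, I5, ?_, ⟨1, ?_⟩, ?_, ?_, ?_⟩, ?_, ?_⟩
  · rw [hc', he', hf', he'', hc'']
    exact simple6 hρ hR hR hR hρ (by linarith) (by linarith) (by linarith) (by linarith)
      (by linarith) (by linarith) (by linarith) (by linarith) (by linarith)
  · unfold IsCCW
    rw [Fin.sum_univ_six]
    refine Eq.trans (congrArg₂ _ (congrArg₂ _ (congrArg₂ _ (congrArg₂ _ (congrArg₂ _ T0 T1)
      T2) T3) T4) T5) ?_
    ring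
  · intro i hi
    fin_cases i
    · exact absurd rfl hi
    · exact I1.trans_lt (by linarith)
    · exact (congrArg (fun x => π - x) T2).trans_lt (by linarith)
    · exact (congrArg (fun x => π - x) T3).trans_lt (by linarith)
    · exact (congrArg (fun x => π - x) T4).trans_lt (by linarith)
    · exact I5.trans_lt (by linarith)
  · rw [hc', hc'']; simp [dist_eq_norm, cis_norm]
  · rw [one_smul, E2, ← neg_sub, E5, show 5 * π / 3 = 2 * π / 3 + π by ring, cis_add_pi]; ring
  · rw [dist_comm, dist_eq_norm, dist_eq_norm, E2, E5]; simp [cis_norm]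
  · rw [he', hf']; simp [dist_eq_norm, cis_norm]
  · rw [he'', hf']; simp [dist_eq_norm, cis_norm]
  · show EuclideanGeometry.angle c' 0 e' = φ
    have := angle_polar (b2 := φ) one_ne_zero E1
      (show e' - 0 = 1 * ((Real.sin (2 * π / 3) : ℝ) * cis φ) by rw [he']; ring)
      hρ hR (by linarith) (by linarith)
    rw [this]; ring
  · show EuclideanGeometry.angle 0 e' f' = α
    rw [EuclideanGeometry.angle_comm]
    have := angle_polar one_ne_zero E3 E0 s3 hR (by linarith) (by linarith)
    rw [this]; ring

lemma omega_sum : cis (2 * π / 3) + cis (4 * π / 3) = -1 := by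
  apply Complex.ext
  · simp only [Complex.add_re, cis_re, Complex.neg_re, Complex.one_re]
    rw [show 2 * π / 3 = π - π / 3 by ring, show 4 * π / 3 = π / 3 + π by ring,
      Real.cos_pi_sub, Real.cos_add_pi, Real.cos_pi_div_three]
    norm_num
  · simp only [Complex.add_im, cis_im, Complex.neg_im, Complex.one_im]
    rw [show 2 * π / 3 = π - π / 3 by ring, show 4 * π / 3 = π / 3 + π by ring,
      Real.sin_pi_sub, Real.sin_add_pi]
    norm_num

lemma struct {a c' e' e'' c'' : ℂ} (h1 : a ≠ c') (h2 : c' ≠ e') (h3 : e'' ≠ c'') (h4 : c'' ≠ a)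
    (t0 : turn c'' a c' = -(π / 3)) (t1 : turn a c' e' = 2 * π / 3)
    (t5 : turn e'' c'' a = 2 * π / 3) (d1 : dist a c' = dist a c'')
    (d2 : dist c' e' = dist c'' e'') :
    ∃ (w : ℂ) (φ : ℝ), w ≠ 0 ∧ 0 < φ ∧ φ < 2 * π / 3 ∧
      c' = a + w * (Real.sin (2 * π / 3 - φ) : ℝ) ∧
      e' = a + w * ((Real.sin (2 * π / 3) : ℝ) * cis φ) ∧
      e'' = a + w * ((Real.sin (2 * π / 3) : ℝ) * cis (4 * π / 3 - φ)) ∧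
      c'' = a + w * ((Real.sin (2 * π / 3 - φ) : ℝ) * cis (4 * π / 3)) := by
  have hpi := Real.pi_pos
  have hR : 0 < Real.sin (2 * π / 3) := Real.sin_pos_of_pos_of_lt_pi (by linarith) (by linarith)
  obtain ⟨L, hL, hL'⟩ := turn_inv h1 h2
  obtain ⟨k, hk, hk'⟩ := turn_inv h4 h1
  obtain ⟨l, hl, hl'⟩ := turn_inv h3 h4
  rw [t1] at hL'
  rw [t0] at hk'
  rw [t5] at hl'
  have n0 : 0 < ‖c' - a‖ := norm_pos_iff.2 (sub_ne_zero.2 h1.symm)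
  have nL := congrArg (fun z : ℂ => ‖z‖) hL'
  have nk := congrArg (fun z : ℂ => ‖z‖) hk'
  have nl := congrArg (fun z : ℂ => ‖z‖) hl'
  simp only [norm_mul, cis_norm, Complex.norm_real, Real.norm_eq_abs, mul_one, abs_of_pos hL,
    abs_of_pos hk, abs_of_pos hl] at nL nk nl
  rw [dist_comm, dist_eq_norm, dist_eq_norm] at d1
  rw [dist_comm, dist_eq_norm, dist_eq_norm] at d2
  have hk1 : k = 1 := by
    rw [← d1] at nk
    have : ‖c' - a‖ * (k - 1) = 0 := by linarith
    rcases mul_eq_zero.1 this with h | h <;> linarith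
  have hl1 : L * l = 1 := by
    rw [← d1, ← d2, nL] at nl
    have : ‖c' - a‖ * (L * l - 1) = 0 := by linarith
    rcases mul_eq_zero.1 this with h | h <;> linarith
  have hl1c : (L : ℂ) * l = 1 := by exact_mod_cast hl1
  subst hk1
  have g1 : a - c'' = (c' - a) * cis (π / 3) := by
    rw [hk', Complex.ofReal_one, one_mul, mul_assoc, ← cis_add, neg_add_cancel, cis_zero, mul_one]
  have g2 : c'' - e'' = (a - c'') * (L * cis (-(2 * π / 3))) := by
    rw [hl']
    have : cis (2 * π / 3) * cis (-(2 * π / 3)) = 1 := by rw [← cis_add, add_neg_cancel, cis_zero]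
    linear_combination (-(c'' - e'') * (L * l)) * this - (c'' - e'') * hl1c
  -- the angle `φ`
  have hmem : (1 : ℂ) + L * cis (2 * π / 3) ∈
      segment ℝ (((2 : ℝ) : ℂ) * cis 0) (((2 * L : ℝ) : ℂ) * cis (2 * π / 3)) := by
    refine ⟨1 / 2, 1 / 2, by norm_num, by norm_num, by norm_num, ?_⟩
    simp only [Complex.real_smul, cis_zero]
    push_cast
    ring
  obtain ⟨r, φ, hr, p1, p2, hZ, -, -⟩ := seg_polar (by norm_num) (by positivity) (by linarith)
    (by linarith) hmem
  have q1 := congrArg Complex.re hZ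
  have q2 := congrArg Complex.im hZ
  simp only [Complex.add_re, Complex.add_im, Complex.mul_re, Complex.mul_im, Complex.ofReal_re,
    Complex.ofReal_im, Complex.one_re, Complex.one_im, cis_re, cis_im] at q1 q2
  have q3 : r * Real.sin (2 * π / 3 - φ) = Real.sin (2 * π / 3) := by
    rw [Real.sin_sub]
    linear_combination (-Real.sin (2 * π / 3)) * q1 + (Real.cos (2 * π / 3)) * q2
  have p1' : 0 < φ := by
    rcases p1.eq_or_lt with h | h
    · rw [← h] at q2
      simp at q2
      rcases q2 with h | h <;> linarith
    · exact h
  have p2' : φ < 2 * π / 3 := by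
    rcases p2.eq_or_lt with h | h
    · rw [h, sub_self] at q3
      simp at q3
      linarith
    · exact h
  have hρ : 0 < Real.sin (2 * π / 3 - φ) := Real.sin_pos_of_pos_of_lt_pi (by linarith) (by linarith)
  have hρc : ((Real.sin (2 * π / 3 - φ) : ℝ) : ℂ) ≠ 0 := by exact_mod_cast hρ.ne'
  have q3c : (r : ℂ) * (Real.sin (2 * π / 3 - φ) : ℝ) = (Real.sin (2 * π / 3) : ℝ) := by
    exact_mod_cast q3
  obtain ⟨w, hw⟩ : ∃ w : ℂ, w = (c' - a) / (Real.sin (2 * π / 3 - φ) : ℝ) := ⟨_, rfl⟩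
  have hw' : c' - a = w * (Real.sin (2 * π / 3 - φ) : ℝ) := by
    rw [hw, div_mul_cancel₀ _ hρc]
  have hZ' := congrArg (starRingEnd ℂ) hZ
  simp only [map_add, map_one, map_mul, Complex.conj_ofReal, cis_conj] at hZ'
  have gc : c'' = a + (c' - a) * cis (4 * π / 3) := by
    rw [show 4 * π / 3 = π / 3 + π by ring, cis_add_pi]
    linear_combination -g1
  refine ⟨w, φ, ?_, p1', p2', ?_, ?_, ?_, ?_⟩
  · rw [hw]; exact div_ne_zero (sub_ne_zero.2 h1.symm) hρc
  · linear_combination hw'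
  · rw [← q3c]
    linear_combination hL' + (c' - a) * hZ + (r * cis φ) * hw'
  · rw [← q3c, sub_eq_add_neg (4 * π / 3), cis_add]
    have e : e'' = c'' - (a - c'') * (L * cis (-(2 * π / 3))) := by linear_combination -g2
    have e2 : a - c'' = -((c' - a) * cis (4 * π / 3)) := by linear_combination -gc
    rw [e, e2]
    linear_combination gc + (c' - a) * cis (4 * π / 3) * hZ' +
      (r * cis (4 * π / 3) * cis (-φ)) * hw'
  · linear_combination gc + cis (4 * π / 3) * hw'

lemma turn_ne_pi {p q r : ℂ} (hp : p ≠ q) (hr : q ≠ r)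
    (h : segment ℝ p q ∩ segment ℝ q r = {q}) : turn p q r ≠ π := by
  intro ht
  obtain ⟨l, hl, hl'⟩ := turn_inv hp hr
  rw [ht, cis_pi] at hl'
  have hr' : r = q + (p - q) * l := by linear_combination hl'
  rcases le_total l 1 with h1 | h1
  · have : r ∈ ({q} : Set ℂ) := by
      rw [← h]
      refine ⟨⟨l, 1 - l, hl.le, by linarith, by ring, ?_⟩, right_mem_segment _ _ _⟩
      rw [hr']
      simp only [Complex.real_smul]; push_cast; ring
    exact hr this.symm
  · have : p ∈ ({q} : Set ℂ) := by
      rw [← h]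
      refine ⟨left_mem_segment _ _ _, ⟨1 - 1 / l, 1 / l, ?_, by positivity, by ring, ?_⟩⟩
      · rw [sub_nonneg, div_le_one hl]; exact h1
      · have hlc : (l : ℂ) ≠ 0 := by exact_mod_cast hl.ne'
        rw [hr']
        simp only [Complex.real_smul]; push_cast; field_simp; ring
    exact hp this

lemma turn_le_pi (p q r : ℂ) : turn p q r ≤ π := Real.Angle.toReal_le_pi _

lemma forward2 {a c' d c'' : ℂ} (h : Is2Special a c' d c'') :
    0 < EuclideanGeometry.angle a c' d ∧ EuclideanGeometry.angle a c' d < π / 3 := by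
  have hpi := Real.pi_pos
  obtain ⟨⟨hn, ha, -⟩, hccw, i0, -, -, i2, -, -⟩ := h
  have n0 : a ≠ c' := hn 0
  have n1 : c' ≠ d := hn 1
  have n2 : d ≠ c'' := hn 2
  have n3 : c'' ≠ a := hn 3
  have t1 := (turn_le_pi a c' d).lt_of_ne (turn_ne_pi n0 n1 (ha 0))
  have t3 := (turn_le_pi d c'' a).lt_of_ne (turn_ne_pi n2 n3 (ha 2))
  have i0' : π - turn c'' a c' = 4 * π / 3 := i0
  have i2' : π - turn c' d c'' = π / 3 := i2
  unfold IsCCW at hccw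
  rw [Fin.sum_univ_four] at hccw
  have hs : turn c'' a c' + turn a c' d + turn c' d c'' + turn d c'' a = 2 * π := hccw
  rw [angle_turn n0 n1, abs_of_pos (by linarith)]
  constructor <;> linarith

lemma forward3 {a c' e' e'' c'' : ℂ} (h : Is3Special a c' e' e'' c'') :
    ∃ φ : ℝ, EuclideanGeometry.angle c' a e' = φ ∧
      EuclideanGeometry.angle a e' e'' = φ - π / 6 ∧ π / 6 < φ ∧ φ < 2 * π / 3 := by
  have hpi := Real.pi_pos
  obtain ⟨⟨hn, ha, hd⟩, -, i0, -, i1, i4, d1, -, d2, -, -⟩ := h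
  have n0 : a ≠ c' := hn 0
  have n1 : c' ≠ e' := hn 1
  have n3 : e'' ≠ c'' := hn 3
  have n4 : c'' ≠ a := hn 4
  have i0' : π - turn c'' a c' = 4 * π / 3 := i0
  have i1' : π - turn a c' e' = π / 3 := i1
  have i4' : π - turn e'' c'' a = π / 3 := i4
  obtain ⟨w, φ, hw, p1, p2, gc', ge', ge'', gc''⟩ := struct n0 n1 n3 n4 (by linarith) (by linarith)
    (by linarith) d1 d2
  have hρ : 0 < Real.sin (2 * π / 3 - φ) := Real.sin_pos_of_pos_of_lt_pi (by linarith) (by linarith)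
  have hR : 0 < Real.sin (2 * π / 3) := Real.sin_pos_of_pos_of_lt_pi (by linarith) (by linarith)
  have hφ : 0 < Real.sin φ := Real.sin_pos_of_pos_of_lt_pi (by linarith) (by linarith)
  have E1 := edge1 gc'
  have E2 := edge2 gc' ge'
  have E3 := edgeChord (b := 7 * π / 6) ge' ge'' (by ring)
  have E5 := edge5 gc'' ge''
  have E0 := edgeBack ge'
  have s3 : 0 < 2 * Real.sin (2 * π / 3) * Real.sin ((4 * π / 3 - φ - φ) / 2) := by
    have := Real.sin_pos_of_pos_of_lt_pi (x := (4 * π / 3 - φ - φ) / 2)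
      (by linarith) (by linarith)
    positivity
  have key : π / 6 < φ := by
    by_contra hcon
    push Not at hcon
    have hdis : segment ℝ a c' ∩ segment ℝ e' e'' = ∅ := hd 0 2 (by decide) (by decide) (by decide)
    have hge : 0 ≤ Real.sin (2 * π / 3 - φ) - 2 * Real.sin φ := by
      have a1 : Real.sin φ ≤ Real.sin (π / 6) :=
        Real.sin_le_sin_of_le_of_le_pi_div_two (by linarith) (by linarith) hcon
      have a2 : Real.cos (π / 6) ≤ Real.cos φ :=
        Real.cos_le_cos_of_nonneg_of_le_pi (by linarith) (by linarith) hcon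
      rw [Real.sin_pi_div_six] at a1
      rw [Real.cos_pi_div_six] at a2
      rw [Real.sin_sub, show 2 * π / 3 = π - π / 3 by ring, Real.sin_pi_sub, Real.cos_pi_sub,
        Real.sin_pi_div_three, Real.cos_pi_div_three]
      have h3 : √3 * √3 = 3 := Real.mul_self_sqrt (by norm_num)
      have h3' : 0 < √3 := by positivity
      nlinarith
    have hρc : ((Real.sin (2 * π / 3 - φ) : ℝ) : ℂ) ≠ 0 := by exact_mod_cast hρ.ne'
    have hmem : a + w * ((Real.sin (2 * π / 3 - φ) - 2 * Real.sin φ : ℝ) : ℂ) ∈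
        segment ℝ a c' ∩ segment ℝ e' e'' := by
      constructor
      · refine ⟨2 * Real.sin φ / Real.sin (2 * π / 3 - φ),
          (Real.sin (2 * π / 3 - φ) - 2 * Real.sin φ) / Real.sin (2 * π / 3 - φ),
          by positivity, by positivity, by rw [← add_div, add_sub_cancel, div_self hρ.ne'], ?_⟩
        rw [gc']
        obtain ⟨ρ, hρe⟩ : ∃ ρ, ρ = Real.sin (2 * π / 3 - φ) := ⟨_, rfl⟩
        rw [← hρe] at hρc ⊢
        simp only [Complex.real_smul, Complex.ofReal_sub, Complex.ofReal_div, Complex.ofReal_mul]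
        push_cast
        field_simp
        ring
      · refine ⟨1 - Real.sin φ / Real.sin (2 * π / 3 - φ),
          Real.sin φ / Real.sin (2 * π / 3 - φ), ?_, by positivity, by ring, ?_⟩
        · rw [sub_nonneg, div_le_one hρ]; linarith
        · have u1 : e' = a + w * ((Real.sin (2 * π / 3 - φ) : ℝ) +
              (Real.sin φ : ℝ) * cis (2 * π / 3)) := by
            linear_combination E2 + gc'
          have u2 : e'' = a + w * ((Real.sin (2 * π / 3 - φ) : ℝ) * cis (4 * π / 3) +
              (Real.sin φ : ℝ) * cis (2 * π / 3)) := by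
            rw [show 5 * π / 3 = 2 * π / 3 + π by ring, cis_add_pi] at E5
            linear_combination gc'' - E5
          have u3 : cis (4 * π / 3) = -1 - cis (2 * π / 3) := by
            linear_combination omega_sum
          rw [u1, u2, u3]
          obtain ⟨ρ, hρe⟩ : ∃ ρ, ρ = Real.sin (2 * π / 3 - φ) := ⟨_, rfl⟩
          rw [← hρe] at hρc ⊢
          simp only [Complex.real_smul]
          rw [Complex.ofReal_sub, Complex.ofReal_sub, Complex.ofReal_div, Complex.ofReal_mul]
          push_cast
          field_simp
          ring
    rw [hdis] at hmem
    exact hmem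
  refine ⟨φ, ?_, ?_, key, p2⟩
  · have := angle_polar (b2 := φ) hw E1
      (show e' - a = w * ((Real.sin (2 * π / 3) : ℝ) * cis φ) by rw [ge']; ring)
      hρ hR (by linarith) (by linarith)
    rw [this]; ring
  · rw [EuclideanGeometry.angle_comm]
    have := angle_polar hw E3 E0 s3 hR (by linarith) (by linarith)
    rw [this]; ring

lemma forward4 {a c' e' f' e'' c'' : ℂ} (h : Is4Special a c' e' f' e'' c'') :
    ∃ φ α : ℝ, EuclideanGeometry.angle c' a e' = φ ∧
      EuclideanGeometry.angle a e' f' = α ∧ 0 < φ ∧ φ < 2 * π / 3 ∧ 0 < α ∧ α < π / 2 ∧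
      φ - π / 6 < α ∧ α < φ + π / 3 := by
  have hpi := Real.pi_pos
  obtain ⟨⟨hn, ha, hd⟩, -, i0, il, i1, i5, d1, -, d2, d3, d4⟩ := h
  have n0 : a ≠ c' := hn 0
  have n1 : c' ≠ e' := hn 1
  have n2 : e' ≠ f' := hn 2
  have n3 : f' ≠ e'' := hn 3
  have n4 : e'' ≠ c'' := hn 4
  have n5 : c'' ≠ a := hn 5
  have i0' : π - turn c'' a c' = 4 * π / 3 := i0
  have i1' : π - turn a c' e' = π / 3 := i1
  have i5' : π - turn e'' c'' a = π / 3 := i5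
  have i2 : π - turn c' e' f' < π := il 2 (by decide)
  have i3 : π - turn e' f' e'' < π := il 3 (by decide)
  have i4 : π - turn f' e'' c'' < π := il 4 (by decide)
  obtain ⟨w, φ, hw, p1, p2, gc', ge', ge'', gc''⟩ := struct n0 n1 n4 n5 (by linarith) (by linarith)
    (by linarith) d1 d2
  have hρ : 0 < Real.sin (2 * π / 3 - φ) := Real.sin_pos_of_pos_of_lt_pi (by linarith) (by linarith)
  have hR : 0 < Real.sin (2 * π / 3) := Real.sin_pos_of_pos_of_lt_pi (by linarith) (by linarith)
  have hφ : 0 < Real.sin φ := Real.sin_pos_of_pos_of_lt_pi (by linarith) (by linarith)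
  have E1 := edge1 gc'
  have E2 := edge2 gc' ge'
  have E5 := edge5 gc'' ge''
  have E0 := edgeBack ge'
  obtain ⟨ψ, hψ0, hψ1, gf'⟩ : ∃ ψ : ℝ, 0 ≤ ψ ∧ ψ < 2 * π ∧
      f' = a + w * ((Real.sin (2 * π / 3) : ℝ) * cis (φ + ψ)) := by
    have hg := polar_form ((f' - a) / w)
    have hnorm : ‖(f' - a) / w‖ = Real.sin (2 * π / 3) := by
      have nw : ‖w‖ ≠ 0 := norm_ne_zero_iff.2 hw
      rw [norm_div, ← dist_eq_norm, dist_comm, ← d3, dist_comm, dist_eq_norm, ge']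
      rw [add_sub_cancel_left, norm_mul, norm_mul, cis_norm, Complex.norm_real, Real.norm_eq_abs,
        abs_of_pos hR, mul_one, mul_div_cancel_left₀ _ nw]
    rw [hnorm] at hg
    have hf : f' = a + w * ((Real.sin (2 * π / 3) : ℝ) * cis (Complex.arg ((f' - a) / w))) := by
      rw [← hg]; field_simp; ring
    have b1 := Complex.neg_pi_lt_arg ((f' - a) / w)
    have b2 := Complex.arg_le_pi ((f' - a) / w)
    rcases le_or_gt 0 (Complex.arg ((f' - a) / w) - φ) with hc | hc
    · refine ⟨_, hc, by linarith, ?_⟩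
      rw [add_sub_cancel]; exact hf
    · refine ⟨Complex.arg ((f' - a) / w) - φ + 2 * π, by linarith, by linarith, ?_⟩
      rw [← add_assoc, add_sub_cancel, cis_add_two_pi]; exact hf
  have hψ0' : 0 < ψ := by
    rcases hψ0.eq_or_lt with h | h
    · exfalso; apply n2; rw [gf', ← h, add_zero, ge']
    · exact h
  have hs1 : 0 < Real.sin ((φ + ψ - φ) / 2) :=
    Real.sin_pos_of_pos_of_lt_pi (by linarith) (by linarith)
  have s3 : 0 < 2 * Real.sin (2 * π / 3) * Real.sin ((φ + ψ - φ) / 2) := by positivity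
  have E3 := edgeChord (b := φ + ψ / 2 + π / 2) ge' gf' (by ring)
  have E4 := edgeChord (b := 2 * π / 3 + ψ / 2 + π / 2) gf' ge'' (by ring)
  have hψS : ψ < 4 * π / 3 - 2 * φ := by
    by_contra hcon
    push Not at hcon
    rcases hcon.eq_or_lt with hc | hc
    · apply n3
      rw [gf', ge'', ← hc]
      congr 4
      ring
    · have hs2 : Real.sin ((4 * π / 3 - φ - (φ + ψ)) / 2) < 0 :=
        Real.sin_neg_of_neg_of_neg_pi_lt (by linarith) (by linarith)
      have s4 : 0 < -(2 * Real.sin (2 * π / 3) * Real.sin ((4 * π / 3 - φ - (φ + ψ)) / 2)) := by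
        nlinarith
      have E4' : e'' - f' = w * (((-(2 * Real.sin (2 * π / 3) *
          Real.sin ((4 * π / 3 - φ - (φ + ψ)) / 2)) : ℝ) : ℂ) *
          cis (2 * π / 3 + ψ / 2 + π / 2 - π)) := by
        rw [E4]
        have : cis (2 * π / 3 + ψ / 2 + π / 2) = - cis (2 * π / 3 + ψ / 2 + π / 2 - π) := by
          rw [← cis_add_pi]; congr 1; ring
        rw [this, Complex.ofReal_neg]; ring
      have T := turn_polar hw E3 E4' s3 s4 (by linarith) (by linarith)
      linarith
  have hs2 : 0 < Real.sin ((4 * π / 3 - φ - (φ + ψ)) / 2) :=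
    Real.sin_pos_of_pos_of_lt_pi (by linarith) (by linarith)
  have s4 : 0 < 2 * Real.sin (2 * π / 3) * Real.sin ((4 * π / 3 - φ - (φ + ψ)) / 2) := by
    positivity
  have T2 := turn_polar hw E2 E3 hφ s3 (by linarith) (by linarith)
  have T4 := turn_polar hw E4 E5 s4 hφ (by linarith) (by linarith)
  refine ⟨φ, (π - ψ) / 2, ?_, ?_, p1, p2, by linarith, by linarith, by linarith, by linarith⟩
  · have := angle_polar (b2 := φ) hw E1
      (show e' - a = w * ((Real.sin (2 * π / 3) : ℝ) * cis φ) by rw [ge']; ring)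
      hρ hR (by linarith) (by linarith)
    rw [this]; ring
  · rw [EuclideanGeometry.angle_comm]
    have := angle_polar hw E3 E0 s3 hR (by linarith) (by linarith)
    rw [this]; ring

/-- The image of the angle-parameter map `P ↦ (φ(P), α(P))` on special
polygons is exactly the set of `(φ, α)` with `0 ≤ φ < 2π/3`, `0 < α ≤ π/2`,
`φ − π/6 ≤ α < φ + π/3` and `α ≠ π/2`. -/
theorem special_polygon_parameter_image :
    {p : ℝ × ℝ | ∃ P : SpecialPolygon, P.phi = p.1 ∧ P.alpha = p.2} =
      {p : ℝ × ℝ | (0 ≤ p.1 ∧ p.1 < 2 * π / 3 ∧ 0 < p.2 ∧ p.2 ≤ π / 2 ∧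
        p.1 - π / 6 ≤ p.2 ∧ p.2 < p.1 + π / 3) ∧ p.2 ≠ π / 2} := by
  have hpi := Real.pi_pos
  ext ⟨x, y⟩
  simp only [Set.mem_ofPred_eq]
  constructor
  · rintro ⟨P, hx, hy⟩
    cases P with
    | two a c' d c'' h =>
      have h2 := forward2 h
      have hx' : (0 : ℝ) = x := hx
      have hy' : EuclideanGeometry.angle a c' d = y := hy
      rw [hy'] at h2
      obtain ⟨h3, h4⟩ := h2
      exact ⟨⟨by linarith, by linarith, by linarith, by linarith, by linarith, by linarith⟩,
        by linarith⟩
    | three a c' e' e'' c'' h =>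
      obtain ⟨φ, h1, h2, h3, h4⟩ := forward3 h
      have hx' : EuclideanGeometry.angle c' a e' = x := hx
      have hy' : EuclideanGeometry.angle a e' e'' = y := hy
      rw [hx'] at h1
      rw [hy'] at h2
      refine ⟨⟨?_, ?_, ?_, ?_, ?_, ?_⟩, ne_of_lt ?_⟩ <;> linarith
    | four a c' e' f' e'' c'' h =>
      obtain ⟨φ, α, h1, h2, h3, h4, h5, h6, h7, h8⟩ := forward4 h
      have hx' : EuclideanGeometry.angle c' a e' = x := hx
      have hy' : EuclideanGeometry.angle a e' f' = y := hy
      rw [hx'] at h1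
      rw [hy'] at h2
      refine ⟨⟨?_, ?_, ?_, ?_, ?_, ?_⟩, ne_of_lt ?_⟩ <;> linarith
  · rintro ⟨⟨h1, h2, h3, h4, h5, h6⟩, h7⟩
    have h8 := lt_of_le_of_ne h4 h7
    rcases h1.eq_or_lt with h | h
    · rw [← h] at h6 ⊢
      exact exists2 h3 (by linarith)
    · rcases h5.eq_or_lt with h' | h'
      · rw [← h']
        exact exists3 (by linarith) h2
      · exact exists4 h h2 h3 h8 h' h6
end

section
/- Let Y = {(φ,α) ∈ ℝ² : 0 ≤ φ < 2π/3, 0 < α ≤ π/2, and φ − π/6 ≤ α < φ + π/3} with the subspace topology from ℝ². Let Z be the quotient space of Y obtained by identifying the point (φ, π/2) with the point (φ, φ − π/6) for every φ with π/6 < φ < 2π/3. Let Ẑ be the quotient of the disjoint union of two copies Z⁺ and Z⁻ of Z obtained by identifying, for every α with 0 < α < π/3, the point of Z⁺ corresponding to (0,α) with the point of Z⁻ corresponding to (0,α). Then Ẑ is homeomorphic to the 2-sphere with three points removed (equivalently, to the Euclidean plane with two points removed). -/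
open Real

/-- The parameter region
`Y = {(φ,α) : 0 ≤ φ < 2π/3, 0 < α ≤ π/2, φ − π/6 ≤ α < φ + π/3}`,
with the subspace topology from `ℝ²`. -/
def Y : Set (ℝ × ℝ) :=
  {p | 0 ≤ p.1 ∧ p.1 < 2 * π / 3 ∧ 0 < p.2 ∧ p.2 ≤ π / 2 ∧
    p.1 - π / 6 ≤ p.2 ∧ p.2 < p.1 + π / 3}

/-- The relation on `Y` identifying `(φ, π/2)` with `(φ, φ − π/6)` for
`π/6 < φ < 2π/3`. -/
def zRel : Y → Y → Prop := fun x y =>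
  π / 6 < (x : ℝ × ℝ).1 ∧ (x : ℝ × ℝ).1 < 2 * π / 3 ∧ (x : ℝ × ℝ).2 = π / 2 ∧
    (y : ℝ × ℝ).1 = (x : ℝ × ℝ).1 ∧ (y : ℝ × ℝ).2 = (x : ℝ × ℝ).1 - π / 6

/-- The quotient space `Z` of `Y` by the identification of `(φ, π/2)` with
`(φ, φ − π/6)` for `π/6 < φ < 2π/3`, with the quotient topology. -/
def Z : Type := Quot zRel

instance : TopologicalSpace Z := inferInstanceAs (TopologicalSpace (Quot zRel))

/-- The relation on `Z ⊕ Z` identifying, for each `0 < α < π/3`, the point of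
the first copy of `Z` corresponding to `(0, α)` with the point of the second
copy corresponding to `(0, α)`. -/
def zHatRel : Z ⊕ Z → Z ⊕ Z → Prop := fun x y =>
  ∃ (α : ℝ) (h : ((0 : ℝ), α) ∈ Y), 0 < α ∧ α < π / 3 ∧
    x = Sum.inl (Quot.mk zRel ⟨((0 : ℝ), α), h⟩) ∧
    y = Sum.inr (Quot.mk zRel ⟨((0 : ℝ), α), h⟩)

/-- The space `Ẑ`: the quotient of `Z ⊕ Z` (two copies `Z⁺`, `Z⁻` of `Z`, with
the disjoint union topology) gluing the two copies along the arc `φ = 0`,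
`0 < α < π/3`, with the quotient topology. -/
def ZHat : Type := Quot zHatRel

instance : TopologicalSpace ZHat := inferInstanceAs (TopologicalSpace (Quot zHatRel))


namespace ZHatAux

/-- positive overshoot -/
noncomputable def w (a t : ℝ) : ℝ := max (2 * t + a - 4) 0
noncomputable def D (a t : ℝ) : ℝ := 4 - 2 * |t| + 2 / 3 * (w a t + w a (-t))
noncomputable def fx (a t : ℝ) : ℝ := (a + 2 / 3 * (w a t + w a (-t))) / D a t
noncomputable def fy (a t : ℝ) : ℝ := 2 * (t - w a t + w a (-t)) / D a t
noncomputable def gN (x y : ℝ) : ℝ := 4 * max (x - 1) 0 + 3 * y + 3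
noncomputable def ga (x y : ℝ) : ℝ := (4 * max (x - 1) 0 + 12 * min x 1) / gN x y
noncomputable def gt (x y : ℝ) : ℝ := (12 * max (x - 1) 0 + 6 * y) / gN x y

/-- model of `Y` -/
def W (a t : ℝ) : Prop := 0 ≤ a ∧ a < 4 ∧ |t| ≤ 4 - a ∧ |t| < 2 + a

lemma W_neg {a t : ℝ} (h : W a t) : W a (-t) := by
  unfold W at *; rwa [abs_neg]

lemma D_neg (a t : ℝ) : D a (-t) = D a t := by
  unfold D; rw [abs_neg, neg_neg]; ring

lemma fx_neg (a t : ℝ) : fx a (-t) = fx a t := by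
  unfold fx; rw [D_neg, neg_neg, add_comm (w a (-t))]

lemma fy_neg (a t : ℝ) : fy a (-t) = - fy a t := by
  unfold fy; rw [D_neg, neg_neg]; ring

/-- values in the upper half -/
lemma core {a t : ℝ} (h : W a t) (ht : 0 ≤ t) :
    (2 * t + a ≤ 4 ∧ 0 < 4 - 2 * t ∧ D a t = 4 - 2 * t ∧ fx a t = a / (4 - 2 * t) ∧
      fy a t = 2 * t / (4 - 2 * t)) ∨
    (4 ≤ 2 * t + a ∧ 0 < 2 + a - t ∧ D a t = 2 * (2 + a - t) / 3 ∧
      fx a t = 1 + 3 * (2 * t + a - 4) / (2 * (2 + a - t)) ∧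
      fy a t = 3 * (4 - a - t) / (2 + a - t)) := by
  obtain ⟨h1, h2, h3, h4⟩ := h
  rw [abs_of_nonneg ht] at h3 h4
  have hw : w a (-t) = 0 := max_eq_right (by linarith)
  rcases le_total (2 * t + a) 4 with hc | hc
  · left
    have hw' : w a t = 0 := max_eq_right (by linarith)
    have hD : D a t = 4 - 2 * t := by
      unfold D; rw [hw, hw', abs_of_nonneg ht]; ring
    have hpos : 0 < 4 - 2 * t := by
      rcases h1.lt_or_eq with h | h
      · linarith
      · linarith
    refine ⟨hc, hpos, hD, ?_, ?_⟩
    · unfold fx; rw [hD, hw, hw']; ring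
    · unfold fy; rw [hD, hw, hw']; ring
  · right
    have hw' : w a t = 2 * t + a - 4 := max_eq_left (by linarith)
    have hD : D a t = 2 * (2 + a - t) / 3 := by
      unfold D; rw [hw, hw', abs_of_nonneg ht]; ring
    have hpos : 0 < 2 + a - t := by linarith
    refine ⟨hc, hpos, hD, ?_, ?_⟩
    · unfold fx; rw [hD, hw, hw']; field_simp; ring
    · unfold fy; rw [hD, hw, hw']; field_simp; ring

lemma D_pos {a t : ℝ} (h : W a t) : 0 < D a t := by
  have key : ∀ {t : ℝ}, W a t → 0 ≤ t → 0 < D a t := by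
    intro t h ht
    rcases core h ht with ⟨_, h2, h3, _⟩ | ⟨_, h2, h3, _⟩
    · rw [h3]; exact h2
    · rw [h3]; linarith
  rcases le_total 0 t with ht | ht
  · exact key h ht
  · rw [← D_neg]; exact key (W_neg h) (by linarith)

/-- left inverse and sign info, upper half -/
lemma core2 {a t : ℝ} (h : W a t) (ht : 0 ≤ t) :
    0 ≤ fx a t ∧ 0 ≤ fy a t ∧ ga (fx a t) (fy a t) = a ∧ gt (fx a t) (fy a t) = t ∧
    ¬ (fx a t = 1 ∧ fy a t = 0) ∧ (fy a t = 0 → t = 0 ∨ t = 4 - a) ∧ (fx a t = 0 → a = 0) := by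
  have hW := h
  obtain ⟨h1, h2, h3, h4⟩ := h
  rw [abs_of_nonneg ht] at h3 h4
  rcases core hW ht with ⟨hc, hp, -, hx, hy⟩ | ⟨hc, hp, -, hx, hy⟩
  · have hx0 : 0 ≤ fx a t := by rw [hx]; positivity
    have hx1 : fx a t ≤ 1 := by rw [hx, div_le_one hp]; linarith
    have hy0 : 0 ≤ fy a t := by rw [hy]; positivity
    have hy00 : fy a t = 0 → t = 0 := by
      rw [hy, div_eq_zero_iff]; rintro (h | h) <;> linarith
    have hm : max (fx a t - 1) 0 = 0 := max_eq_right (by linarith)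
    have hm' : min (fx a t) 1 = fx a t := min_eq_left hx1
    have hN : gN (fx a t) (fy a t) = 12 / (4 - 2 * t) := by
      unfold gN; rw [hm, hy]; field_simp; ring
    refine ⟨hx0, hy0, ?_, ?_, ?_, fun h => Or.inl (hy00 h), ?_⟩
    · unfold ga; rw [hN, hm, hm', hx]; field_simp; ring
    · unfold gt; rw [hN, hm, hy]; field_simp; ring
    · rintro ⟨ha, hb⟩
      have := hy00 hb
      rw [hx, div_eq_one_iff_eq hp.ne'] at ha
      linarith
    · rw [hx, div_eq_zero_iff]; rintro (h | h) <;> linarith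
  · have hq : 0 ≤ 3 * (2 * t + a - 4) / (2 * (2 + a - t)) := by
      apply div_nonneg <;> linarith
    have hx1 : 1 ≤ fx a t := by rw [hx]; linarith
    have hy0 : 0 ≤ fy a t := by rw [hy]; apply div_nonneg <;> linarith
    have hy00 : fy a t = 0 → t = 4 - a := by
      rw [hy, div_eq_zero_iff]; rintro (h | h) <;> linarith
    have hm : max (fx a t - 1) 0 = 3 * (2 * t + a - 4) / (2 * (2 + a - t)) := by
      rw [max_eq_left (by linarith), hx]; ring
    have hm' : min (fx a t) 1 = 1 := min_eq_right hx1
    have hN : gN (fx a t) (fy a t) = 18 / (2 + a - t) := by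
      unfold gN; rw [hm, hy]; field_simp; ring
    refine ⟨by linarith, hy0, ?_, ?_, ?_, fun h => Or.inr (hy00 h), ?_⟩
    · unfold ga; rw [hN, hm, hm']; field_simp; ring
    · unfold gt; rw [hN, hm, hy]; field_simp; ring
    · rintro ⟨ha, hb⟩
      have := hy00 hb
      rw [hx] at ha
      have h0 : 3 * (2 * t + a - 4) / (2 * (2 + a - t)) = 0 := by linarith
      rw [div_eq_zero_iff] at h0
      rcases h0 with h | h <;> linarith
    · intro h; linarith

lemma fx_abs (a t : ℝ) : fx a |t| = fx a t := by
  rcases abs_choice t with h | h <;> rw [h]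
  exact fx_neg a t

lemma W_abs {a t : ℝ} (h : W a t) : W a |t| := by
  unfold W at *; rwa [abs_abs]

lemma fy_abs {a t : ℝ} (h : W a t) : fy a |t| = |fy a t| := by
  have := (core2 (W_abs h) (abs_nonneg t)).2.1
  rcases abs_choice t with h | h
  · rw [h] at this ⊢; rw [abs_of_nonneg this]
  · rw [h] at this ⊢; rw [← abs_neg (fy a t), ← fy_neg, abs_of_nonneg this]

lemma f_inj {a t a' t' : ℝ} (h : W a t) (h' : W a' t') (hx : fx a t = fx a' t')
    (hy : fy a t = fy a' t') : a = a' ∧ (t = t' ∨ (|t| = 4 - a ∧ t' = -t)) := by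
  have k := core2 (W_abs h) (abs_nonneg t)
  have k' := core2 (W_abs h') (abs_nonneg t')
  rw [fx_abs, fy_abs h] at k
  rw [fx_abs, fy_abs h', ← hx, ← hy] at k'
  have haa : a = a' := k.2.2.1.symm.trans k'.2.2.1
  have htt : |t| = |t'| := k.2.2.2.1.symm.trans k'.2.2.2.1
  refine ⟨haa, ?_⟩
  rcases abs_eq_abs.mp htt with e | e
  · exact Or.inl e
  · have hf : fy a t = 0 := by
      have : fy a t = - fy a t := by
        conv_lhs => rw [e, fy_neg, haa, ← hy]
      linarith
    rcases k.2.2.2.2.2.1 (by rw [hf, abs_zero]) with h0 | h0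
    · left
      have : t = 0 := abs_eq_zero.mp h0
      linarith
    · right; exact ⟨h0, by linarith⟩

lemma f_glue {a t : ℝ} (h : W a t) (e : |t| = 4 - a) : fy a t = 0 := by
  rw [← abs_eq_zero, ← fy_abs h]
  have hW := W_abs h
  obtain ⟨h1, h2, h3, h4⟩ := h
  rcases core (W_abs ⟨h1, h2, h3, h4⟩) (abs_nonneg t) with ⟨hc, hp, -, hx, hy⟩ | ⟨hc, hp, -, hx, hy⟩
  · linarith
  · rw [hy, e]; simp

lemma gN_pos {x y : ℝ} (hy : 0 ≤ y) : 0 < gN x y := by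
  have := le_max_right (x - 1) 0
  unfold gN; linarith

lemma gsec {x y : ℝ} (hx : 0 ≤ x) (hy : 0 ≤ y) (h : ¬ (x = 1 ∧ y = 0)) :
    W (ga x y) (gt x y) ∧ 0 ≤ gt x y ∧ fx (ga x y) (gt x y) = x ∧ fy (ga x y) (gt x y) = y := by
  have hN := gN_pos (x := x) hy
  rcases le_total x 1 with hc | hc
  · have e1 : max (x - 1) 0 = 0 := max_eq_right (by linarith)
    have e2 : min x 1 = x := min_eq_left hc
    have eN : gN x y = 3 * y + 3 := by unfold gN; rw [e1]; ring
    have ea : ga x y = 4 * x / (y + 1) := by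
      unfold ga; rw [eN, e1, e2]; field_simp; ring
    have et : gt x y = 2 * y / (y + 1) := by
      unfold gt; rw [eN, e1]; field_simp; ring
    have p : 0 < y + 1 := by linarith
    have t0 : 0 ≤ gt x y := by rw [et]; positivity
    have hW : W (ga x y) (gt x y) := by
      unfold W
      rw [abs_of_nonneg t0, ea, et]
      refine ⟨by positivity, ?_, ?_, ?_⟩
      · rw [div_lt_iff₀ p]
        by_contra hh
        exact h ⟨by linarith, by linarith⟩
      · rw [le_sub_iff_add_le, ← add_div, div_le_iff₀ p]; linarith
      · rw [← sub_lt_iff_lt_add, ← sub_div, div_lt_iff₀ p]; linarith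
    refine ⟨hW, t0, ?_⟩
    have e4 : 4 - 2 * (2 * y / (y + 1)) = 4 / (y + 1) := by field_simp; ring
    rcases core hW t0 with ⟨hc, hp, -, hx, hy⟩ | ⟨hc, hp, -, hx, hy⟩
    · rw [hx, hy, ea, et, e4]; constructor <;> field_simp <;> ring
    · have e3 : x = 1 := by
        rw [ea, et, mul_div_assoc', ← add_div, le_div_iff₀ p] at hc; linarith
      have e5 : 2 + 4 * x / (y + 1) - 2 * y / (y + 1) = 6 / (y + 1) := by
        rw [e3]; field_simp; ring
      rw [hx, hy, ea, et, e5, e3]; constructor <;> field_simp <;> ring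
  · have e1 : max (x - 1) 0 = x - 1 := max_eq_left (by linarith)
    have e2 : min x 1 = 1 := min_eq_right hc
    have eN : gN x y = 4 * x + 3 * y - 1 := by unfold gN; rw [e1]; ring
    have ea : ga x y = (4 * x + 8) / (4 * x + 3 * y - 1) := by
      unfold ga; rw [eN, e1, e2]; ring
    have et : gt x y = (12 * x - 12 + 6 * y) / (4 * x + 3 * y - 1) := by
      unfold gt; rw [eN, e1]; ring
    have p : 0 < 4 * x + 3 * y - 1 := by linarith
    have t0 : 0 ≤ gt x y := by rw [et]; apply div_nonneg <;> linarith
    have hW : W (ga x y) (gt x y) := by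
      unfold W
      rw [abs_of_nonneg t0, ea, et]
      refine ⟨by positivity, ?_, ?_, ?_⟩
      · rw [div_lt_iff₀ p]
        by_contra hh
        exact h ⟨by linarith, by linarith⟩
      · rw [le_sub_iff_add_le, ← add_div, div_le_iff₀ p]; linarith
      · rw [← sub_lt_iff_lt_add, ← sub_div, div_lt_iff₀ p]; linarith
    refine ⟨hW, t0, ?_⟩
    rcases core hW t0 with ⟨hc, hp, -, hx, hy⟩ | ⟨hc, hp, -, hx, hy⟩
    · have e3 : x = 1 := by
        rw [ea, et, mul_div_assoc', ← add_div, div_le_iff₀ p] at hc; linarith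
      subst e3
      have p' : y + 1 ≠ 0 := by positivity
      have q1 : ga 1 y = 4 / (y + 1) := by
        rw [ea, div_eq_div_iff p.ne' p']; ring
      have q2 : gt 1 y = 2 * y / (y + 1) := by
        rw [et, div_eq_div_iff p.ne' p']; ring
      have e4 : 4 - 2 * (2 * y / (y + 1)) = 4 / (y + 1) := by field_simp; ring
      rw [hx, hy, q1, q2, e4]; constructor <;> field_simp <;> ring
    · have e5 : 2 + ga x y - gt x y = 18 / (4 * x + 3 * y - 1) := by
        rw [ea, et, eq_div_iff p.ne', sub_mul, add_mul, div_mul_cancel₀ _ p.ne',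
          div_mul_cancel₀ _ p.ne']; ring
      have e6 : 2 * gt x y + ga x y - 4 = 12 * (x - 1) / (4 * x + 3 * y - 1) := by
        rw [ea, et, eq_div_iff p.ne', sub_mul, add_mul, mul_assoc, div_mul_cancel₀ _ p.ne',
          div_mul_cancel₀ _ p.ne']; ring
      have e7 : 4 - ga x y - gt x y = 6 * y / (4 * x + 3 * y - 1) := by
        rw [ea, et, eq_div_iff p.ne', sub_mul, sub_mul, div_mul_cancel₀ _ p.ne',
          div_mul_cancel₀ _ p.ne']; ring
      rw [hx, hy, e5, e6, e7]
      have p' := p.ne'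
      generalize 4 * x + 3 * y - 1 = n at p'
      constructor <;> field_simp <;> ring

/-- coordinates on `Y` -/
noncomputable def ca (p : ℝ × ℝ) : ℝ := 6 * p.1 / π
noncomputable def ct (p : ℝ × ℝ) : ℝ := 12 * p.2 / π - 2 - 6 * p.1 / π
noncomputable def cinv (a t : ℝ) : ℝ × ℝ := (π / 6 * a, π / 6 * (1 + (a + t) / 2))

lemma cinv_c (p : ℝ × ℝ) : cinv (ca p) (ct p) = p := by
  have := pi_ne_zero
  unfold cinv ca ct
  ext <;> simp <;> field_simp <;> ring

lemma ca_cinv (a t : ℝ) : ca (cinv a t) = a := by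
  have := pi_ne_zero
  unfold cinv ca; simp; field_simp

lemma ct_cinv (a t : ℝ) : ct (cinv a t) = t := by
  have := pi_ne_zero
  unfold cinv ct; simp; field_simp; ring

lemma cinv_mem (a t : ℝ) : cinv a t ∈ Y ↔ W a t := by
  have hp := pi_pos
  unfold Y W cinv
  simp only [Set.mem_ofPred_eq, abs_le, abs_lt]
  constructor
  · rintro ⟨h1, h2, h3, h4, h5, h6⟩
    refine ⟨?_, ?_, ⟨?_, ?_⟩, ?_, ?_⟩ <;> by_contra! hh <;> nlinarith
  · rintro ⟨h1, h2, ⟨h3, h4⟩, h5, h6⟩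
    refine ⟨?_, ?_, ?_, ?_, ?_, ?_⟩ <;> by_contra! hh <;> nlinarith

lemma mem_W (p : Y) : W (ca p) (ct p) := by
  rw [← cinv_mem, cinv_c]; exact p.2

lemma zRel_cinv {x y : Y} (h : ca x = ca y) (h2 : |ct x| = 4 - ca x) (h3 : ct y = - ct x) :
    Quot.mk zRel x = Quot.mk zRel y := by
  have key : ∀ {x y : Y}, ca x = ca y → ct x = 4 - ca x → ct y = - ct x → zRel x y := by
    intro x y h h2 h3
    have hx := cinv_c x
    have hy := cinv_c y
    have hW := mem_W x
    have hp := pi_pos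
    obtain ⟨w1, w2, w3, w4⟩ := hW
    have w5 := lt_of_le_of_lt (le_abs_self _) w4
    rw [h3, ← h, h2] at hy
    rw [h2] at hx
    unfold zRel
    rw [← hx, ← hy]
    unfold cinv
    dsimp only
    refine ⟨?_, ?_, ?_, ?_, ?_⟩
    · nlinarith
    · nlinarith
    · ring
    · rfl
    · ring
  rcases abs_choice (ct x) with e | e <;> rw [e] at h2
  · exact Quot.sound (key h h2 h3)
  · exact (Quot.sound (key h.symm (by rw [h3, h2, h]) (by rw [h3, neg_neg]))).symm

lemma zRel_c {x y : Y} (h : zRel x y) : fx (ca x) (ct x) = fx (ca y) (ct y) ∧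
    fy (ca x) (ct x) = fy (ca y) (ct y) := by
  have hW := mem_W x
  have hW' := mem_W y
  have hp := pi_ne_zero
  obtain ⟨h1, h2, h3, h4, h5⟩ := h
  have e1 : ca y = ca x := by unfold ca; rw [h4]
  have e2 : ct x = 4 - ca x := by unfold ca ct; rw [h3]; field_simp; ring
  have e3 : ct y = - ct x := by unfold ct; rw [h3, h4, h5]; field_simp; ring
  have hn : |ct x| = 4 - ca x := by rw [← e2, abs_of_nonneg]; rw [e2]; linarith [hW.2.1]
  refine ⟨by rw [e1, e3, fx_neg], ?_⟩
  rw [f_glue hW hn, f_glue hW' (by rw [e3, abs_neg, hn, e1])]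

abbrev T : Set (ℝ × ℝ) := ({((0 : ℝ), (0 : ℝ)), ((1 : ℝ), (0 : ℝ))}ᶜ : Set (ℝ × ℝ))

lemma mem_T (p : ℝ × ℝ) : p ∈ T ↔ ¬ (|2 * p.1 - 1| = 1 ∧ |p.2| = 0) := by
  obtain ⟨x, y⟩ := p
  simp only [T, Set.mem_compl_iff, Set.mem_insert_iff, Set.mem_singleton_iff, Prod.mk.injEq,
    abs_eq_zero, abs_eq (zero_le_one' ℝ)]
  rw [not_iff_not]
  constructor
  · rintro (⟨rfl, rfl⟩ | ⟨rfl, rfl⟩) <;> norm_num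
  · rintro ⟨h | h, rfl⟩
    · right; exact ⟨by linarith, rfl⟩
    · left; exact ⟨by linarith, rfl⟩

lemma fx_nonneg {a t : ℝ} (h : W a t) : 0 ≤ fx a t := by
  rw [← fx_abs]; exact (core2 (W_abs h) (abs_nonneg t)).1

lemma fx_zero {a t : ℝ} (h : W a t) : fx a t = 0 ↔ a = 0 := by
  constructor
  · intro e
    rw [← fx_abs] at e; exact (core2 (W_abs h) (abs_nonneg t)).2.2.2.2.2.2 e
  · intro e
    obtain ⟨h1, h2, h3, h4⟩ := h
    obtain ⟨h5, h6⟩ := abs_lt.mp h4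
    have i1 : w a t = 0 := max_eq_right (by linarith)
    have i2 : w a (-t) = 0 := max_eq_right (by linarith)
    unfold fx; rw [i1, i2, e]; simp

lemma f_ne {a t : ℝ} (h : W a t) : ¬ (fx a t = 1 ∧ |fy a t| = 0) := by
  rw [← fx_abs, ← fy_abs h]; exact (core2 (W_abs h) (abs_nonneg t)).2.2.2.2.1

/-- the map on one copy, `e = ±1` -/
noncomputable def F (e : ℝ) (he : |e| = 1) (p : Y) : T :=
  ⟨((1 + e * fx (ca p) (ct p)) / 2, fy (ca p) (ct p)), by
    rw [mem_T]
    have h := f_ne (mem_W p)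
    have : |2 * ((1 + e * fx (ca p) (ct p)) / 2) - 1| = fx (ca p) (ct p) := by
      rw [show 2 * ((1 + e * fx (ca p) (ct p)) / 2) - 1 = e * fx (ca p) (ct p) by ring,
        abs_mul, he, one_mul, abs_of_nonneg (fx_nonneg (mem_W p))]
    simpa only [this] using h⟩

lemma F_cont (e : ℝ) (he : |e| = 1) : Continuous (F e he) := by
  have h1 : Continuous fun p : Y => ca p := by unfold ca; fun_prop
  have h2 : Continuous fun p : Y => ct p := by unfold ct; fun_prop
  have w1 : Continuous fun p : Y => w (ca p) (ct p) := by unfold w; fun_prop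
  have w2 : Continuous fun p : Y => w (ca p) (- ct p) := by unfold w; fun_prop
  have hD : Continuous fun p : Y => D (ca p) (ct p) := by unfold D; fun_prop
  have hD' : ∀ p : Y, D (ca p) (ct p) ≠ 0 := fun p => (D_pos (mem_W p)).ne'
  have f1 : Continuous fun p : Y => fx (ca p) (ct p) := by
    unfold fx; exact Continuous.div (by fun_prop) hD hD'
  have f2 : Continuous fun p : Y => fy (ca p) (ct p) := by
    unfold fy; exact Continuous.div (by fun_prop) hD hD'
  unfold F
  exact Continuous.subtype_mk (by fun_prop) _

noncomputable def FZ (e : ℝ) (he : |e| = 1) : Z → T :=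
  Quot.lift (F e he) (by
    intro x y h
    obtain ⟨h1, h2⟩ := zRel_c h
    unfold F; simp only [h1, h2])

lemma FZ_cont (e : ℝ) (he : |e| = 1) : Continuous (FZ e he) :=
  continuous_quot_lift _ (F_cont e he)

end ZHatAux

namespace ZHatAux

lemma F_inj {e : ℝ} {he : |e| = 1} {x y : Y} (h : F e he x = F e he y) :
    Quot.mk zRel x = Quot.mk zRel y := by
  have h' := congrArg Subtype.val h
  simp only [F, Prod.mk.injEq] at h'
  obtain ⟨h1, h2⟩ := h'
  have e0 : e ≠ 0 := by rintro rfl; simp at he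
  have h3 : fx (ca x) (ct x) = fx (ca y) (ct y) :=
    mul_left_cancel₀ e0 (by linarith)
  obtain ⟨ha, ht | ⟨ht, ht'⟩⟩ := f_inj (mem_W x) (mem_W y) h3 h2
  · have : x = y := Subtype.ext (by rw [← cinv_c x, ← cinv_c y, ha, ht])
    rw [this]
  · exact zRel_cinv ha ht ht'

lemma abs_one' : |(1 : ℝ)| = 1 := abs_one
lemma abs_neg_one' : |(-1 : ℝ)| = 1 := by simp

lemma F_cross {x y : Y} (h : F 1 abs_one' x = F (-1) abs_neg_one' y) :
    zHatRel (Sum.inl (Quot.mk zRel x)) (Sum.inr (Quot.mk zRel y)) := by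
  have h' := congrArg Subtype.val h
  simp only [F, Prod.mk.injEq] at h'
  obtain ⟨h1, h2⟩ := h'
  have hx := fx_nonneg (mem_W x)
  have hy := fx_nonneg (mem_W y)
  have ax := (fx_zero (mem_W x)).mp (by linarith)
  have e : x = y := by
    obtain ⟨ha, ht | ⟨ht, ht'⟩⟩ := f_inj (mem_W x) (mem_W y) (by linarith) h2
    · exact Subtype.ext (by rw [← cinv_c x, ← cinv_c y, ha, ht])
    · have := (mem_W x).2.2.2
      linarith
  subst e
  obtain ⟨⟨p, q⟩, hp⟩ := x
  have p0 : p = 0 := by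
    have := cinv_c (p, q)
    simp only at ax
    rw [ax] at this
    simpa [cinv] using (congrArg Prod.fst this).symm
  subst p0
  have hp' := hp
  obtain ⟨_, _, h3, _, _, h6⟩ := hp'
  exact ⟨q, hp, h3, by simpa using h6, rfl, rfl⟩

noncomputable def FH : ZHat → T :=
  Quot.lift (Sum.elim (FZ 1 abs_one') (FZ (-1) abs_neg_one')) (by
    rintro x y ⟨α, h, h1, h2, rfl, rfl⟩
    have hz : fx (ca (0, α)) (ct (0, α)) = 0 := by
      rw [fx_zero (mem_W ⟨(0, α), h⟩)]; simp [ca]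
    change F 1 abs_one' ⟨(0, α), h⟩ = F (-1) abs_neg_one' ⟨(0, α), h⟩
    simp only [F, hz, mul_zero])

lemma FH_cont : Continuous FH :=
  continuous_quot_lift _ ((FZ_cont _ _).sumElim (FZ_cont _ _))

lemma FH_inj : Function.Injective FH := by
  rintro ⟨x | x⟩ ⟨y | y⟩ h <;> obtain ⟨x, rfl⟩ := Quot.exists_rep x <;>
    obtain ⟨y, rfl⟩ := Quot.exists_rep y
  · have : Quot.mk zRel x = Quot.mk zRel y := F_inj (e := 1) (he := abs_one') h
    rw [this]
  · exact Quot.sound (F_cross h)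
  · exact (Quot.sound (F_cross h.symm)).symm
  · have : Quot.mk zRel x = Quot.mk zRel y := F_inj (e := -1) (he := abs_neg_one') h
    rw [this]

/-- partial section -/
noncomputable def sec (d : ℝ) (hd : |d| = 1) (p : T) : Y :=
  ⟨cinv (ga |2 * p.1.1 - 1| |p.1.2|) (d * gt |2 * p.1.1 - 1| |p.1.2|), by
    have h := (gsec (abs_nonneg _) (abs_nonneg _) ((mem_T p.1).mp p.2)).1
    rw [cinv_mem]
    unfold W at *
    rwa [abs_mul, hd, one_mul]⟩

lemma sec_cont (d : ℝ) (hd : |d| = 1) : Continuous (sec d hd) := by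
  have hN : Continuous fun p : T => gN |2 * p.1.1 - 1| |p.1.2| := by unfold gN; fun_prop
  have hN' : ∀ p : T, gN |2 * p.1.1 - 1| |p.1.2| ≠ 0 := fun p => (gN_pos (abs_nonneg _)).ne'
  have h1 : Continuous fun p : T => ga |2 * p.1.1 - 1| |p.1.2| := by
    unfold ga; exact Continuous.div (by fun_prop) hN hN'
  have h2 : Continuous fun p : T => gt |2 * p.1.1 - 1| |p.1.2| := by
    unfold gt; exact Continuous.div (by fun_prop) hN hN'
  unfold sec cinv
  exact Continuous.subtype_mk (by fun_prop) _

def C (e d : ℝ) : Set T := {p | 0 ≤ e * (2 * p.1.1 - 1) ∧ 0 ≤ d * p.1.2}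

lemma C_closed (e d : ℝ) : IsClosed (C e d) := by
  have h1 : IsClosed {p : T | 0 ≤ e * (2 * p.1.1 - 1)} :=
    isClosed_le (by fun_prop) (by fun_prop)
  have h2 : IsClosed {p : T | 0 ≤ d * p.1.2} := isClosed_le (by fun_prop) (by fun_prop)
  have : C e d = {p : T | 0 ≤ e * (2 * p.1.1 - 1)} ∩ {p : T | 0 ≤ d * p.1.2} := by
    ext p; exact Iff.rfl
  rw [this]
  exact h1.inter h2

lemma mul_abs' {e x : ℝ} (he : |e| = 1) (h : 0 ≤ e * x) : e * |x| = x := by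
  rw [← one_mul |x|, ← he, ← abs_mul, abs_of_nonneg h, ← mul_assoc, ← abs_mul_abs_self e, he]
  ring

lemma F_sec (e d : ℝ) (he : |e| = 1) (hd : |d| = 1) (p : T) (hp : p ∈ C e d) :
    F e he (sec d hd p) = p := by
  obtain ⟨h1, h2⟩ := hp
  obtain ⟨hW, ht, hx, hy⟩ := gsec (abs_nonneg _) (abs_nonneg _) ((mem_T p.1).mp p.2)
  apply Subtype.ext
  simp only [F, sec, ca_cinv, ct_cinv]
  have ex : ∀ a t, fx a (d * t) = fx a t := by
    intro a t
    rcases (abs_eq zero_le_one).mp hd with rfl | rfl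
    · rw [one_mul]
    · rw [neg_one_mul, fx_neg]
  have ey : ∀ a t, fy a (d * t) = d * fy a t := by
    intro a t
    rcases (abs_eq zero_le_one).mp hd with rfl | rfl
    · rw [one_mul, one_mul]
    · rw [neg_one_mul, fy_neg, neg_one_mul]
  rw [ex, ey, hx, hy, mul_abs' he h1, mul_abs' hd h2]
  ext
  · simp
  · rfl

lemma exists_sign (x : ℝ) : 0 ≤ (1 : ℝ) * x ∨ 0 ≤ (-1 : ℝ) * x := by
  rcases le_total 0 x with h | h
  · left; linarith
  · right; linarith

lemma C_cover (p : T) : (p ∈ C 1 1 ∨ p ∈ C 1 (-1)) ∨ (p ∈ C (-1) 1 ∨ p ∈ C (-1) (-1)) := by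
  rcases exists_sign (2 * p.1.1 - 1) with h | h <;> rcases exists_sign p.1.2 with h' | h'
  · exact Or.inl (Or.inl ⟨h, h'⟩)
  · exact Or.inl (Or.inr ⟨h, h'⟩)
  · exact Or.inr (Or.inl ⟨h, h'⟩)
  · exact Or.inr (Or.inr ⟨h, h'⟩)

/-- quotient map of the copy of sign `e` -/
def qp (x : Y) : ZHat := Quot.mk zHatRel (Sum.inl (Quot.mk zRel x))
def qm (x : Y) : ZHat := Quot.mk zHatRel (Sum.inr (Quot.mk zRel x))

lemma qp_cont : Continuous qp :=
  continuous_quot_mk.comp (continuous_inl.comp continuous_quot_mk)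
lemma qm_cont : Continuous qm :=
  continuous_quot_mk.comp (continuous_inr.comp continuous_quot_mk)

lemma piece (e d : ℝ) (s : T → ZHat) (hs : Continuous s) (h : ∀ p ∈ C e d, FH (s p) = p)
    (K : Set ZHat) (hK : IsClosed K) : IsClosed (FH '' K ∩ C e d) := by
  have : FH '' K ∩ C e d = s ⁻¹' K ∩ C e d := by
    ext p
    constructor
    · rintro ⟨⟨k, hk, rfl⟩, hc⟩
      refine ⟨?_, hc⟩
      have := FH_inj (h _ hc)
      simpa only [Set.mem_preimage, this] using hk
    · rintro ⟨hk, hc⟩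
      exact ⟨⟨s p, hk, h p hc⟩, hc⟩
  rw [this]
  exact (hK.preimage hs).inter (C_closed e d)

lemma sp (d : ℝ) (hd : |d| = 1) : ∀ p ∈ C 1 d, FH (qp (sec d hd p)) = p :=
  fun p hp => F_sec 1 d abs_one' hd p hp
lemma sm (d : ℝ) (hd : |d| = 1) : ∀ p ∈ C (-1) d, FH (qm (sec d hd p)) = p :=
  fun p hp => F_sec (-1) d abs_neg_one' hd p hp

lemma FH_surj : Function.Surjective FH := by
  intro p
  rcases C_cover p with (h | h) | (h | h)
  · exact ⟨_, sp 1 abs_one' p h⟩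
  · exact ⟨_, sp (-1) abs_neg_one' p h⟩
  · exact ⟨_, sm 1 abs_one' p h⟩
  · exact ⟨_, sm (-1) abs_neg_one' p h⟩

lemma FH_closed : IsClosedMap FH := by
  intro K hK
  have : FH '' K = ((FH '' K ∩ C 1 1) ∪ (FH '' K ∩ C 1 (-1))) ∪
      ((FH '' K ∩ C (-1) 1) ∪ (FH '' K ∩ C (-1) (-1))) := by
    ext p
    have := C_cover p
    simp only [Set.mem_union, Set.mem_inter_iff]
    tauto
  rw [this]
  refine ((piece _ _ _ (qp_cont.comp (sec_cont 1 abs_one')) (sp _ _) K hK).union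
    (piece _ _ _ (qp_cont.comp (sec_cont (-1) abs_neg_one')) (sp _ _) K hK)).union
    ((piece _ _ _ (qm_cont.comp (sec_cont 1 abs_one')) (sm _ _) K hK).union
    (piece _ _ _ (qm_cont.comp (sec_cont (-1) abs_neg_one')) (sm _ _) K hK))

end ZHatAux

/-- `Ẑ` is homeomorphic to the 2-sphere with three points removed,
equivalently to the Euclidean plane with two points removed. -/
theorem zHat_homeomorph_plane_minus_two_points :
    Nonempty (ZHat ≃ₜ ({((0 : ℝ), (0 : ℝ)), ((1 : ℝ), (0 : ℝ))}ᶜ : Set (ℝ × ℝ))) := by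
  exact ⟨(Equiv.ofBijective ZHatAux.FH ⟨ZHatAux.FH_inj, ZHatAux.FH_surj⟩).toHomeomorphOfContinuousClosed
    ZHatAux.FH_cont ZHatAux.FH_closed⟩
end
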